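/- arXiv:0709.2590 — 12 statements merged into one kernel-verified Lean document; each statement's English description precedes it below -/
import Mathlib

section
/- Let q be a positive integer and γ ∈ SL(2,ℤ). Then there exists a unique positive divisor w of q such that the double coset Γ₀(q)·γ·V contains a matrix whose lower-right entry equals w; that is, there exist δ ∈ Γ₀(q) and n ∈ ℤ with the lower-right entry of δ·γ·[[1,0],[1,1]]ⁿ equal to w, and if two matrices in the same double coset have positive lower-right entries w and w′ both dividing q, then w = w′. -/
open Matrix MatrixGroups

/-- The matrix `[[1,0],[1,1]]` as an element of `SL(2, ℤ)`, the generator of `V`. -/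
def Vgen : SL(2, ℤ) :=
  ⟨!![1, 0; 1, 1], by rw [Matrix.det_fin_two_of]; ring⟩

theorem mul_Vgen_apply_one_one (g : SL(2, ℤ)) : (g * Vgen : SL(2, ℤ)) 1 1 = g 1 1 := by
  have h : (g * Vgen : SL(2, ℤ)) 1 1 = g 1 0 * Vgen 0 1 + g 1 1 * Vgen 1 1 := by
    simp [Matrix.mul_apply, Fin.sum_univ_two]
  simpa [Vgen] using h

theorem mul_Vgen_zpow_apply_one_one (g : SL(2, ℤ)) (n : ℤ) :
    (g * Vgen ^ n : SL(2, ℤ)) 1 1 = g 1 1 := by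
  induction n with
  | zero => simp
  | succ n ih => rw [_root_.zpow_add_one, ← mul_assoc, mul_Vgen_apply_one_one, ih]
  | pred n ih =>
    rw [← mul_Vgen_apply_one_one, mul_assoc, ← _root_.zpow_add_one, sub_add_cancel, ih]

theorem doset_apply_one_one (δ γ : SL(2, ℤ)) (n : ℤ) :
    (δ * γ * Vgen ^ n : SL(2, ℤ)) 1 1 = δ 1 0 * γ 0 1 + δ 1 1 * γ 1 1 := by
  rw [mul_Vgen_zpow_apply_one_one]
  simp [Matrix.mul_apply, Fin.sum_univ_two]

/-- A column of coprime integers `b, d` can be scaled modulo `q * b` so that `d` becomes a divisor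
of `q`. -/
theorem exists_divisor_eq_mul_add_mul {q : ℕ} (hq : 0 < q) {b d : ℤ} (h : IsCoprime b d) :
    ∃ w : ℕ, w ∣ q ∧ ∃ D k : ℤ, IsCoprime D q ∧ q * k * b + D * d = w := by
  rcases eq_or_ne b 0 with rfl | hb
  · have hd : IsUnit d := isCoprime_zero_left.mp h
    refine ⟨1, one_dvd q, d, 0, ⟨d, 0, by simp [Int.isUnit_mul_self hd]⟩, ?_⟩
    simp [Int.isUnit_mul_self hd]
  · have : NeZero (q * b.natAbs) := ⟨by positivity⟩
    obtain ⟨w, hw, u, hu, hdu⟩ := ZMod.eq_unit_mul_divisor (N := q * b.natAbs) (d : ZMod _)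
    obtain ⟨u, rfl⟩ := hu
    obtain ⟨D, hD⟩ := ZMod.intCast_surjective (u⁻¹ : (ZMod (q * b.natAbs))ˣ).val
    obtain ⟨U, hU⟩ := ZMod.intCast_surjective (u : ZMod (q * b.natAbs))
    have hN : ((q * b.natAbs : ℕ) : ℤ) ∣ q * b ∧ (q * b : ℤ) ∣ ((q * b.natAbs : ℕ) : ℤ) := by
      push_cast
      exact ⟨mul_dvd_mul_left _ ((abs_dvd _ _).mpr dvd_rfl),
        mul_dvd_mul_left _ ((dvd_abs _ _).mpr dvd_rfl)⟩
    have hdw : (q * b : ℤ) ∣ w - D * d := by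
      refine hN.2.trans ((ZMod.intCast_zmod_eq_zero_iff_dvd _ _).mp ?_)
      push_cast
      rw [hD, hdu, Units.inv_mul_cancel_left, sub_self]
    have hDU : (q * b : ℤ) ∣ 1 - D * U := by
      refine hN.2.trans ((ZMod.intCast_zmod_eq_zero_iff_dvd _ _).mp ?_)
      push_cast
      rw [hD, hU, Units.inv_mul, sub_self]
    have hUw : (q * b : ℤ) ∣ d - U * w := by
      refine hN.2.trans ((ZMod.intCast_zmod_eq_zero_iff_dvd _ _).mp ?_)
      push_cast
      rw [hU, hdu, sub_self]
    have hwN : (w : ℤ) ∣ q * b := (Int.natCast_dvd_natCast.mpr hw).trans hN.1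
    have hwd : (w : ℤ) ∣ d := (dvd_sub_left (dvd_mul_left _ _)).mp (hwN.trans hUw)
    have hwb : IsCoprime (w : ℤ) b := (h.of_isCoprime_of_dvd_right hwd).symm
    obtain ⟨k, hk⟩ := hdw
    obtain ⟨l, hl⟩ := hDU
    exact ⟨w, Int.natCast_dvd_natCast.mp (hwb.dvd_of_dvd_mul_right hwN), D, k,
      ⟨U, b * l, by linear_combination -hl⟩, by linear_combination -hk⟩

theorem eq_gcd_of_mul_add_mul_eq {q w : ℕ} {b c d D : ℤ} (hw : w ∣ q) (hc : (q : ℤ) ∣ c)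
    (hcD : IsCoprime c D) (h : c * b + D * d = w) : w = Int.gcd d q := by
  have hqD : IsCoprime (q : ℤ) D := hcD.of_isCoprime_of_dvd_left hc
  have hwq : (w : ℤ) ∣ q := Int.natCast_dvd_natCast.mpr hw
  apply Nat.dvd_antisymm
  · refine Int.dvd_gcd ((hqD.of_isCoprime_of_dvd_left hwq).dvd_of_dvd_mul_left ?_) hwq
    exact (dvd_add_right ((hwq.trans hc).mul_right b)).mp h.symm.dvd
  · rw [← Int.natCast_dvd_natCast, ← h]
    exact dvd_add (((Int.gcd_dvd_right _ _).trans hc).mul_right b)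
      ((Int.gcd_dvd_left _ _).mul_left D)

/-- There is a unique positive divisor `w` of `q` such that the double coset
`Γ₀(q)·γ·V` contains a matrix whose lower-right entry equals `w`. -/
theorem unique_divisor_in_doset (q : ℕ) (hq : 0 < q) (γ : SL(2, ℤ)) :
    ∃! w : ℕ, 0 < w ∧ w ∣ q ∧
      ∃ δ ∈ CongruenceSubgroup.Gamma0 q, ∃ n : ℤ,
        ((δ * γ * Vgen ^ n : SL(2, ℤ)) 1 1) = (w : ℤ) := by
  have hγ : IsCoprime (γ 0 1) (γ 1 1) :=
    ⟨-γ 1 0, γ 0 0, by linear_combination γ.det_coe.symm.trans (det_fin_two _) |>.symm⟩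
  refine existsUnique_of_exists_of_unique ?_ ?_
  · obtain ⟨w, hw, D, k, hD, h⟩ := exists_divisor_eq_mul_add_mul hq hγ
    have hwD : IsCoprime D (w : ℤ) :=
      hD.of_isCoprime_of_dvd_right (Int.natCast_dvd_natCast.mpr hw)
    have hkD : IsCoprime k D := by
      obtain ⟨x, y, hxy⟩ := hwD
      exact ⟨y * q * γ 0 1, x + y * γ 1 1, by linear_combination hxy + y * h⟩
    obtain ⟨δ, h0, h1⟩ := (hD.symm.mul_left hkD).exists_SL2_row 1
    refine ⟨w, Nat.pos_of_dvd_of_pos hw hq, hw, δ, ?_, 0, ?_⟩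
    · rw [CongruenceSubgroup.Gamma0_mem, h0]
      simp
    · rw [doset_apply_one_one, h0, h1, h]
  · rintro w w' ⟨-, hw, δ, hδ, n, h⟩ ⟨-, hw', δ', hδ', n', h'⟩
    rw [doset_apply_one_one] at h h'
    rw [CongruenceSubgroup.Gamma0_mem, ZMod.intCast_zmod_eq_zero_iff_dvd] at hδ hδ'
    rw [eq_gcd_of_mul_add_mul_eq hw hδ (SpecialLinearGroup.isCoprime_row δ 1) h,
      eq_gcd_of_mul_add_mul_eq hw' hδ' (SpecialLinearGroup.isCoprime_row δ' 1) h']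
end

section
/- Let q be a positive integer, w a positive divisor of q, and let γ₁ = [[e₁,f₁],[g₁,w]] and γ₂ = [[e₂,f₂],[g₂,w]] be two matrices in SL(2,ℤ) with the same lower-right entry w. Then γ₂ belongs to the double coset Γ₀(q)·γ₁·V (i.e. there exist δ ∈ Γ₀(q) and n ∈ ℤ with γ₂ = δ·γ₁·[[1,0],[1,1]]ⁿ) if and only if g₁ ≡ g₂ (mod gcd(w, q/w)). -/
open Matrix MatrixGroups

theorem coe_Vgen_zpow (n : ℤ) : (↑(Vgen ^ n) : Matrix (Fin 2) (Fin 2) ℤ) = !![1, 0; n, 1] := by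
  induction n using Int.induction_on with
  | zero => simp [Matrix.one_fin_two]
  | succ n h =>
    rw [_root_.zpow_add_one, Matrix.SpecialLinearGroup.coe_mul, h]
    simp [Vgen]
  | pred n h =>
    rw [_root_.zpow_sub_one, Matrix.SpecialLinearGroup.coe_mul, h, Matrix.SpecialLinearGroup.coe_inv]
    simp [Vgen, Matrix.adjugate_fin_two_of, sub_eq_add_neg]

theorem lowerLeft_mul_inv_mul_Vgen_zpow (γ₁ γ₂ : SL(2, ℤ)) (n : ℤ) :
    (γ₂ * (γ₁ * Vgen ^ n)⁻¹) 1 0 = γ₂ 1 0 * γ₁ 1 1 - γ₂ 1 1 * (γ₁ 1 0 + n * γ₁ 1 1) := by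
  rw [Matrix.SpecialLinearGroup.coe_mul, Matrix.SpecialLinearGroup.coe_inv, Matrix.SpecialLinearGroup.coe_mul,
    coe_Vgen_zpow, Matrix.adjugate_fin_two]
  simp [Matrix.mul_apply, Fin.sum_univ_two]
  ring

theorem exists_dvd_sub_mul_iff (a b c : ℤ) :
    (∃ n : ℤ, b ∣ c - n * a) ↔ (Int.gcd a b : ℤ) ∣ c := by
  rw [Int.coe_gcd, gcd_dvd_iff_exists]
  constructor
  · rintro ⟨n, m, h⟩
    exact ⟨n, m, by linarith⟩
  · rintro ⟨n, m, h⟩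
    exact ⟨n, m, by linarith⟩

/-- Two matrices in `SL(2,ℤ)` with the same lower-right entry `w` (a positive divisor of `q`)
lie in the same double coset `Γ₀(q)·γ·V` iff their lower-left entries are congruent
modulo `gcd(w, q/w)`. -/
theorem doset_mem_iff_congruent (q w : ℕ) (hq : 0 < q) (hw : 0 < w) (hwq : w ∣ q)
    (γ₁ γ₂ : SL(2, ℤ)) (h₁ : γ₁ 1 1 = (w : ℤ)) (h₂ : γ₂ 1 1 = (w : ℤ)) :
    (∃ δ ∈ CongruenceSubgroup.Gamma0 q, ∃ n : ℤ, γ₂ = δ * γ₁ * Vgen ^ n) ↔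
      γ₁ 1 0 ≡ γ₂ 1 0 [ZMOD (Nat.gcd w (q / w))] := by
  obtain ⟨k, rfl⟩ := hwq
  have hw' : (w : ℤ) ≠ 0 := by exact_mod_cast hw.ne'
  have hmem (n : ℤ) : γ₂ * (γ₁ * Vgen ^ n)⁻¹ ∈ CongruenceSubgroup.Gamma0 (w * k) ↔
      (k : ℤ) ∣ γ₂ 1 0 - γ₁ 1 0 - n * w := by
    rw [CongruenceSubgroup.Gamma0_mem, ZMod.intCast_zmod_eq_zero_iff_dvd,
      lowerLeft_mul_inv_mul_Vgen_zpow, h₁, h₂, Nat.cast_mul,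
      ← mul_dvd_mul_iff_left (b := (k : ℤ)) hw']
    ring_nf
  rw [Nat.mul_div_cancel_left k hw, Int.modEq_iff_dvd, ← Int.gcd_natCast_natCast,
    ← exists_dvd_sub_mul_iff]
  constructor
  · rintro ⟨δ, hδ, n, h⟩
    refine ⟨n, (hmem n).1 ?_⟩
    rwa [h, mul_assoc δ, mul_inv_cancel_right]
  · rintro ⟨n, hn⟩
    exact ⟨_, (hmem n).2 hn, n, by rw [mul_assoc, inv_mul_cancel_right]⟩
end

section
/- Let q be a positive integer, w a positive divisor of q, and u an integer with gcd(u,w) = 1. Let γ = [[a,b],[c,d]] ∈ SL(2,ℤ) with q ∣ c. Then γ fixes the cusp u/w parabolically, i.e. a·u·w + b·w² = c·u² + d·u·w and a + d = 2, if and only if there exists ν ∈ ℤ with lcm(w², q) ∣ ν such that a·w = w + ν·u, b·w² = −ν·u², c = ν, and d·w = w − ν·u. (This identifies the stabilizer of the cusp u/w in Γ₀(q).) -/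
open Matrix MatrixGroups

/-- Identification of the stabilizer of the cusp `u/w` in `Γ₀(q)`: a matrix
`[[a,b],[c,d]] ∈ SL(2,ℤ)` with `q ∣ c` fixes `u/w` parabolically iff its entries have the
shape `[[1+νu/w, -νu²/w²],[ν, 1-νu/w]]` with `lcm(w², q) ∣ ν`. -/
theorem stabilizer_of_cusp (q w : ℕ) (hq : 0 < q) (hw : 0 < w) (hwq : w ∣ q)
    (u : ℤ) (hu : Int.gcd u (w : ℤ) = 1)
    (a b c d : ℤ) (hdet : a * d - b * c = 1) (hc : (q : ℤ) ∣ c) :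
    (a * u * w + b * (w : ℤ) ^ 2 = c * u ^ 2 + d * u * w ∧ a + d = 2) ↔
      ∃ ν : ℤ, ((Nat.lcm (w ^ 2) q : ℕ) : ℤ) ∣ ν ∧
        a * w = w + ν * u ∧ b * (w : ℤ) ^ 2 = -(ν * u ^ 2) ∧ c = ν ∧ d * w = w - ν * u := by
  constructor
  · rintro ⟨hfix, htr⟩
    obtain rfl : d = 2 - a := by linarith
    have hsq : (c * u - (a - 1) * w) ^ 2 = 0 := by
      linear_combination (-c) * hfix - (w : ℤ) ^ 2 * hdet
    have hcu : c * u - (a - 1) * w = 0 := pow_eq_zero_iff two_ne_zero |>.mp hsq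
    have hb : b * (w : ℤ) ^ 2 = -(c * u ^ 2) := by
      linear_combination hfix + 2 * u * hcu
    have hcop : IsCoprime ((w : ℤ) ^ 2) (u ^ 2) :=
      (Int.isCoprime_iff_gcd_eq_one.mpr hu).symm.pow
    have hwc : (w : ℤ) ^ 2 ∣ c :=
      hcop.dvd_of_dvd_mul_right ⟨-b, by linear_combination hb⟩
    refine ⟨c, ?_, by linear_combination -hcu, hb, rfl, by linear_combination hcu⟩
    rw [Int.natCast_dvd]
    exact Nat.lcm_dvd (Int.natCast_dvd.mp (by exact_mod_cast hwc)) (Int.natCast_dvd.mp hc)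
  · rintro ⟨ν, -, ha, hb, rfl, hd⟩
    have hw' : (w : ℤ) ≠ 0 := by exact_mod_cast hw.ne'
    refine ⟨by linear_combination u * ha + hb - u * hd, mul_right_cancel₀ hw' ?_⟩
    linear_combination ha + hd
end

section
/- Let q be a positive integer and suppose q = v₁·w₁ = v₂·w₂ with gcd(v₁,w₁) = gcd(v₂,w₂) = 1, where all factors are positive. Let w̄₁, w̄₂ be integers with v₁ ∣ (w₁·w̄₁ − 1) and v₂ ∣ (w₂·w̄₂ − 1), and set Mᵢ = [[1, −w̄ᵢ],[wᵢ, 1 − wᵢ·w̄ᵢ]] ∈ SL(2,ℤ). Then for every A ∈ SL(2,ℤ): M₁·A·M₂⁻¹ ∈ Γ₀(q) if and only if gcd(v₁,w₂) divides the upper-left entry of A, gcd(v₁,v₂) divides the upper-right entry, gcd(w₁,w₂) divides the lower-left entry, and gcd(w₁,v₂) divides the lower-right entry. Equivalently, M₁⁻¹·Γ₀(q)·M₂ = { [[gcd(v₁,w₂)·k, gcd(v₁,v₂)·l],[gcd(w₁,w₂)·r, gcd(w₁,v₂)·s]] ∈ SL(2,ℤ) : k,l,r,s ∈ ℤ }.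 -/
open Matrix MatrixGroups

lemma IsCoprime.mul_dvd_iff {R : Type*} [CommSemiring R] {a b x : R} (h : IsCoprime a b) :
    a * b ∣ x ↔ a ∣ x ∧ b ∣ x :=
  ⟨fun hx => ⟨dvd_of_mul_right_dvd hx, dvd_of_mul_left_dvd hx⟩, fun hx => h.mul_dvd hx.1 hx.2⟩

/-- A divisor `k` of a product `m * n` of coprime numbers divides `x` iff both `gcd k m` and
`gcd k n` do. -/
lemma Nat.Coprime.intCast_dvd_iff_gcd_dvd {k m n : ℕ} (h : Nat.Coprime m n) (hk : k ∣ m * n)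
    (x : ℤ) : (k : ℤ) ∣ x ↔ (Nat.gcd k m : ℤ) ∣ x ∧ (Nat.gcd k n : ℤ) ∣ x := by
  have hcop : Nat.Coprime (Nat.gcd k m) (Nat.gcd k n) :=
    (h.coprime_dvd_left (Nat.gcd_dvd_right k m)).coprime_dvd_right (Nat.gcd_dvd_right k n)
  rw [← hcop.isCoprime.mul_dvd_iff, ← Nat.cast_mul, ← h.gcd_mul, Nat.gcd_eq_left hk]

/-- If `x` is congruent to `s * t * y` modulo `g`, where `s` and `t` are units modulo `g`, then
`g` divides `x` iff it divides `y`. -/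
lemma dvd_iff_dvd_of_dvd_sub_mul_mul {R : Type*} [CommRing R] {g s t x y : R}
    (hs : IsCoprime g s) (ht : IsCoprime g t) (h : g ∣ x - s * t * y) : g ∣ x ↔ g ∣ y := by
  rw [dvd_iff_dvd_of_dvd_sub h]
  exact ⟨(hs.mul_right ht).dvd_of_dvd_mul_left, fun hy => hy.mul_left _⟩

/-- Bruhat-type description of `M₁⁻¹·Γ₀(q)·M₂` for the scaling matrices attached to two
coprime factorizations `q = v₁·w₁ = v₂·w₂`: for `A ∈ SL(2,ℤ)`, one has
`M₁·A·M₂⁻¹ ∈ Γ₀(q)` iff the four entries of `A` are divisible by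
`gcd(v₁,w₂)`, `gcd(v₁,v₂)`, `gcd(w₁,w₂)`, `gcd(w₁,v₂)` respectively. -/
theorem mem_Gamma0_iff_entries_divisible (q v₁ w₁ v₂ w₂ : ℕ) (hq : 0 < q)
    (hv₁ : 0 < v₁) (hw₁ : 0 < w₁) (hv₂ : 0 < v₂) (hw₂ : 0 < w₂)
    (hq₁ : q = v₁ * w₁) (hq₂ : q = v₂ * w₂)
    (hcop₁ : Nat.Coprime v₁ w₁) (hcop₂ : Nat.Coprime v₂ w₂)
    (wb₁ wb₂ : ℤ) (hwb₁ : (v₁ : ℤ) ∣ (w₁ * wb₁ - 1)) (hwb₂ : (v₂ : ℤ) ∣ (w₂ * wb₂ - 1))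
    (M₁ M₂ : SL(2, ℤ))
    (hM₁ : (M₁ : Matrix (Fin 2) (Fin 2) ℤ) = !![1, -wb₁; (w₁ : ℤ), 1 - w₁ * wb₁])
    (hM₂ : (M₂ : Matrix (Fin 2) (Fin 2) ℤ) = !![1, -wb₂; (w₂ : ℤ), 1 - w₂ * wb₂])
    (A : SL(2, ℤ)) :
    M₁ * A * M₂⁻¹ ∈ CongruenceSubgroup.Gamma0 q ↔
      ((Nat.gcd v₁ w₂ : ℤ) ∣ A 0 0 ∧ (Nat.gcd v₁ v₂ : ℤ) ∣ A 0 1 ∧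
        (Nat.gcd w₁ w₂ : ℤ) ∣ A 1 0 ∧ (Nat.gcd w₁ v₂ : ℤ) ∣ A 1 1) := by
  have hentry : (M₁ * A * M₂⁻¹) 1 0 =
      (w₁ * A 0 0 + (1 - w₁ * wb₁) * A 1 0) * (1 - w₂ * wb₂) -
        (w₁ * A 0 1 + (1 - w₁ * wb₁) * A 1 1) * w₂ := by
    simp [hM₁, hM₂, adjugate_fin_two, mul_apply, vecMul, dotProduct]
    ring
  rw [CongruenceSubgroup.Gamma0_mem, ZMod.intCast_zmod_eq_zero_iff_dvd, hentry]
  set X : ℤ := (w₁ * A 0 0 + (1 - w₁ * wb₁) * A 1 0) * (1 - w₂ * wb₂) -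
    (w₁ * A 0 1 + (1 - w₁ * wb₁) * A 1 1) * w₂ with hX
  have hqX : (q : ℤ) ∣ X ↔ (v₁ : ℤ) ∣ X ∧ (w₁ : ℤ) ∣ X := by
    rw [hq₁, Nat.cast_mul, hcop₁.isCoprime.mul_dvd_iff]
  have hv₁q : v₁ ∣ v₂ * w₂ := hq₂ ▸ hq₁ ▸ dvd_mul_right v₁ w₁
  have hw₁q : w₁ ∣ v₂ * w₂ := hq₂ ▸ hq₁ ▸ dvd_mul_left w₁ v₁
  rw [hqX, hcop₂.intCast_dvd_iff_gcd_dvd hv₁q, hcop₂.intCast_dvd_iff_gcd_dvd hw₁q]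
  have left_dvd (m n : ℕ) : (Nat.gcd m n : ℤ) ∣ m := by exact_mod_cast Nat.gcd_dvd_left m n
  have right_dvd (m n : ℕ) : (Nat.gcd m n : ℤ) ∣ n := by exact_mod_cast Nat.gcd_dvd_right m n
  have cv₁ : IsCoprime (v₁ : ℤ) w₁ := hcop₁.isCoprime
  have cv₂ : IsCoprime (v₂ : ℤ) w₂ := hcop₂.isCoprime
  have cw₁ : IsCoprime (w₁ : ℤ) (1 - w₁ * wb₁) := ⟨wb₁, 1, by ring⟩
  have cw₂ : IsCoprime (w₂ : ℤ) (1 - w₂ * wb₂) := ⟨wb₂, 1, by ring⟩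
  have dv₁ : (v₁ : ℤ) ∣ 1 - w₁ * wb₁ := dvd_sub_comm.mp hwb₁
  have dv₂ : (v₂ : ℤ) ∣ 1 - w₂ * wb₂ := dvd_sub_comm.mp hwb₂
  have h00 : (Nat.gcd v₁ w₂ : ℤ) ∣ X ↔ (Nat.gcd v₁ w₂ : ℤ) ∣ A 0 0 := by
    refine dvd_iff_dvd_of_dvd_sub_mul_mul (cv₁.of_isCoprime_of_dvd_left (left_dvd _ _))
      (cw₂.of_isCoprime_of_dvd_left (right_dvd _ _)) ?_
    obtain ⟨x, hx⟩ := (left_dvd v₁ w₂).trans dv₁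
    obtain ⟨y, hy⟩ := right_dvd v₁ w₂
    exact ⟨x * (A 1 0 * (1 - w₂ * wb₂) - A 1 1 * w₂) - y * w₁ * A 0 1, by
      linear_combination hX + (A 1 0 * (1 - w₂ * wb₂) - A 1 1 * w₂) * hx - w₁ * A 0 1 * hy⟩
  have h01 : (Nat.gcd v₁ v₂ : ℤ) ∣ X ↔ (Nat.gcd v₁ v₂ : ℤ) ∣ A 0 1 := by
    refine dvd_iff_dvd_of_dvd_sub_mul_mul (cv₁.of_isCoprime_of_dvd_left (left_dvd _ _))
      (cv₂.neg_right.of_isCoprime_of_dvd_left (right_dvd _ _)) ?_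
    obtain ⟨x, hx⟩ := (left_dvd v₁ v₂).trans dv₁
    obtain ⟨y, hy⟩ := (right_dvd v₁ v₂).trans dv₂
    exact ⟨x * (A 1 0 * (1 - w₂ * wb₂) - A 1 1 * w₂) + y * w₁ * A 0 0, by
      linear_combination hX + (A 1 0 * (1 - w₂ * wb₂) - A 1 1 * w₂) * hx + w₁ * A 0 0 * hy⟩
  have h10 : (Nat.gcd w₁ w₂ : ℤ) ∣ X ↔ (Nat.gcd w₁ w₂ : ℤ) ∣ A 1 0 := by
    refine dvd_iff_dvd_of_dvd_sub_mul_mul (cw₁.of_isCoprime_of_dvd_left (left_dvd _ _))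
      (cw₂.of_isCoprime_of_dvd_left (right_dvd _ _)) ?_
    obtain ⟨x, hx⟩ := left_dvd w₁ w₂
    obtain ⟨y, hy⟩ := right_dvd w₁ w₂
    exact ⟨x * (A 0 0 * (1 - w₂ * wb₂) - A 0 1 * w₂) - y * (1 - w₁ * wb₁) * A 1 1, by
      linear_combination hX + (A 0 0 * (1 - w₂ * wb₂) - A 0 1 * w₂) * hx -
        (1 - w₁ * wb₁) * A 1 1 * hy⟩
  have h11 : (Nat.gcd w₁ v₂ : ℤ) ∣ X ↔ (Nat.gcd w₁ v₂ : ℤ) ∣ A 1 1 := by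
    refine dvd_iff_dvd_of_dvd_sub_mul_mul (cw₁.of_isCoprime_of_dvd_left (left_dvd _ _))
      (cv₂.neg_right.of_isCoprime_of_dvd_left (right_dvd _ _)) ?_
    obtain ⟨x, hx⟩ := left_dvd w₁ v₂
    obtain ⟨y, hy⟩ := (right_dvd w₁ v₂).trans dv₂
    exact ⟨x * (A 0 0 * (1 - w₂ * wb₂) - A 0 1 * w₂) + y * (1 - w₁ * wb₁) * A 1 0, by
      linear_combination hX + (A 0 0 * (1 - w₂ * wb₂) - A 0 1 * w₂) * hx +
        (1 - w₁ * wb₁) * A 1 0 * hy⟩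
  rw [h00, h01, h10, h11]
  tauto
end

section
/- Let c and d be coprime positive integers, and let u, v, w, z be complex numbers each with real part > 1. Then ∑_{k,l ≥ 1, gcd(c·k, d·l) = 1} k^{−u} l^{−v} · ( ∑_{m,n ≥ 1, c·k·m = d·l·n} m^{−w} n^{−z} ) = c^{−z} d^{−w} · ζ(w+z) ζ(u+z) ζ(v+w) / ζ(u+v+w+z) · ∏_{p ∣ cd} (1 − p^{−(u+v+w+z)})^{−1} · ∏_{p ∣ c} (1 − p^{−(v+w)}) · ∏_{p ∣ d} (1 − p^{−(u+z)}), where p runs over primes. -/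
open Complex

/-- The function `n ↦ n⁻ˢ` on positive integers, restricted to those coprime to `N`. -/
noncomputable def coprimePow (N : ℕ) (s : ℂ) (n : ℕ+) : ℂ :=
  if Nat.Coprime n N then (n : ℂ) ^ (-s) else 0

lemma coprimePow_mul (N : ℕ) (s : ℂ) (m n : ℕ+) :
    coprimePow N s (m * n) = coprimePow N s m * coprimePow N s n := by
  simp only [coprimePow, PNat.mul_coe, Nat.coprime_mul_iff_left, Nat.cast_mul,
    Complex.natCast_mul_natCast_cpow]
  split_ifs <;> simp_all

lemma coprimePow_mul_coprimePow (M N : ℕ) (s t : ℂ) (n : ℕ+) :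
    coprimePow M s n * coprimePow N t n = coprimePow (N * M) (s + t) n := by
  have hn : (n : ℂ) ≠ 0 := by exact_mod_cast n.ne_zero
  simp only [coprimePow, Nat.coprime_mul_iff_right, neg_add, Complex.cpow_add _ _ hn]
  split_ifs <;> simp_all

lemma summable_norm_coprimePow (N : ℕ) {s : ℂ} (hs : 1 < s.re) :
    Summable fun n : ℕ+ ↦ ‖coprimePow N s n‖ := by
  have h := (Real.summable_nat_rpow.2 (neg_lt_neg hs)).comp_injective PNat.coe_injective
  refine Summable.of_nonneg_of_le (fun _ ↦ norm_nonneg _) (fun n ↦ ?_) h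
  unfold coprimePow
  split_ifs
  · rw [Complex.norm_natCast_cpow_of_pos n.pos]; rfl
  · simp only [norm_zero, Function.comp_apply]; positivity

lemma tsum_coprimePow (N : ℕ) [NeZero N] {s : ℂ} (hs : 1 < s.re) :
    ∑' n : ℕ+, coprimePow N s n =
      (∏ p ∈ N.primeFactors, (1 - (p : ℂ) ^ (-s))) * riemannZeta s := by
  have hs1 : s ≠ 1 := by rintro rfl; simp at hs
  rw [← DirichletCharacter.LFunctionTrivChar_eq_mul_riemannZeta hs1,
    DirichletCharacter.LFunctionTrivChar, DirichletCharacter.LFunction_eq_LSeries _ hs, LSeries,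
    ← PNat.coe_injective.tsum_eq (f := LSeries.term _ s)]
  · refine tsum_congr fun n ↦ ?_
    rw [LSeries.term_of_ne_zero n.ne_zero, coprimePow]
    split_ifs with h
    · rw [MulChar.one_apply ((ZMod.isUnit_iff_coprime _ _).2 h), Complex.cpow_neg, one_div]
    · rw [MulChar.map_nonunit _ (mt (ZMod.isUnit_iff_coprime _ _).1 h), zero_div]
  · intro n hn
    have h0 : n ≠ 0 := by rintro rfl; simp at hn
    exact ⟨⟨n, Nat.pos_of_ne_zero h0⟩, rfl⟩

lemma tsum_pnat_cpow {s : ℂ} (hs : 1 < s.re) :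
    ∑' n : ℕ+, (n : ℂ) ^ (-s) = riemannZeta s := by
  simpa [coprimePow] using tsum_coprimePow 1 hs

/-- Every pair of positive integers is uniquely `(g * k, g * l)` with `k` and `l` coprime. -/
lemma bijective_mul_coprime :
    Function.Bijective fun x : {x : ℕ+ × ℕ+ × ℕ+ // Nat.Coprime x.2.1 x.2.2} ↦
      (x.1.1 * x.1.2.1, x.1.1 * x.1.2.2) := by
  constructor
  · rintro ⟨⟨g, k, l⟩, h⟩ ⟨⟨g', k', l'⟩, h'⟩ he
    simp only [Prod.mk.injEq] at he h h'
    obtain ⟨h1, h2⟩ := he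
    have hg : g = g' := by
      apply PNat.coe_injective
      have e1 : (g * k : ℕ) = g' * k' := by exact_mod_cast congrArg PNat.val h1
      have e2 : (g * l : ℕ) = g' * l' := by exact_mod_cast congrArg PNat.val h2
      have := congrArg₂ Nat.gcd e1 e2
      rwa [Nat.gcd_mul_left, Nat.gcd_mul_left, h, h', mul_one, mul_one] at this
    subst hg
    simp only [mul_right_inj] at h1 h2
    subst h1 h2
    rfl
  · rintro ⟨m, n⟩
    obtain ⟨k, l, h, hk, hl⟩ := Nat.exists_coprime m n
    have hk0 : 0 < k := Nat.pos_of_ne_zero (by rintro rfl; simp at hk)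
    have hl0 : 0 < l := Nat.pos_of_ne_zero (by rintro rfl; simp at hl)
    lift k to ℕ+ using hk0
    lift l to ℕ+ using hl0
    refine ⟨⟨(PNat.gcd m n, k, l), h⟩, Prod.ext (PNat.coe_injective ?_) (PNat.coe_injective ?_)⟩
    · rw [PNat.mul_coe, PNat.gcd_coe, mul_comm, ← hk]
    · rw [PNat.mul_coe, PNat.gcd_coe, mul_comm, ← hl]

lemma tsum_eq_tsum_mul_coprime (F : ℕ+ × ℕ+ → ℂ) :
    ∑' q, F q = ∑' x : ℕ+ × ℕ+ × ℕ+,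
      if Nat.Coprime x.2.1 x.2.2 then F (x.1 * x.2.1, x.1 * x.2.2) else 0 := by
  rw [← (Equiv.ofBijective _ bijective_mul_coprime).tsum_eq F]
  rw [← Subtype.val_injective.tsum_eq
    (g := (Subtype.val : {x : ℕ+ × ℕ+ × ℕ+ // Nat.Coprime x.2.1 x.2.2} → _))]
  · refine tsum_congr fun x ↦ ?_
    rw [if_pos x.2]
    rfl
  · intro x hx
    by_contra h
    exact hx (if_neg fun h' ↦ h ⟨⟨x, h'⟩, rfl⟩)

lemma summable_norm_coprime_pair (M N : ℕ) {s t : ℂ} (hs : 1 < s.re) (ht : 1 < t.re) :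
    Summable fun q : ℕ+ × ℕ+ ↦
      ‖if Nat.Coprime q.1 q.2 then coprimePow M s q.1 * coprimePow N t q.2 else 0‖ := by
  refine Summable.of_nonneg_of_le (fun _ ↦ norm_nonneg _) (fun q ↦ ?_)
    ((summable_norm_coprimePow M hs).mul_of_nonneg (summable_norm_coprimePow N ht)
      (fun _ ↦ norm_nonneg _) (fun _ ↦ norm_nonneg _))
  split_ifs
  · rw [norm_mul]
  · rw [norm_zero]; positivity

/-- Sorting pairs by their greatest common divisor factors the full double series. -/
lemma tsum_coprimePow_mul_tsum_coprimePow (M N : ℕ) {s t : ℂ} (hs : 1 < s.re) (ht : 1 < t.re) :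
    (∑' k, coprimePow M s k) * ∑' l, coprimePow N t l =
      (∑' g, coprimePow (N * M) (s + t) g) * ∑' q : ℕ+ × ℕ+,
        if Nat.Coprime q.1 q.2 then coprimePow M s q.1 * coprimePow N t q.2 else 0 := by
  have hst : 1 < (s + t).re := by rw [Complex.add_re]; linarith
  rw [tsum_mul_tsum_of_summable_norm (summable_norm_coprimePow M hs)
      (summable_norm_coprimePow N ht), tsum_eq_tsum_mul_coprime,
    tsum_mul_tsum_of_summable_norm (summable_norm_coprimePow _ hst)
      (summable_norm_coprime_pair M N hs ht)]
  refine tsum_congr fun x ↦ ?_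
  split_ifs
  · simp only [coprimePow_mul, ← coprimePow_mul_coprimePow]
    ring
  · rw [mul_zero]

/-- The solutions of `a * m = b * n` for coprime `a`, `b` are the multiples of `(b, a)`. -/
lemma tsum_tsum_of_mul_eq_mul {a b : ℕ} (ha : 0 < a) (hb : 0 < b) (hab : Nat.Coprime a b)
    {w z : ℂ} (hw : 1 < w.re) (hz : 1 < z.re) :
    ∑' m : ℕ+, ∑' n : ℕ+,
      (if a * m = b * n then (m : ℂ) ^ (-w) * (n : ℂ) ^ (-z) else 0) =
      (b : ℂ) ^ (-w) * (a : ℂ) ^ (-z) * riemannZeta (w + z) := by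
  lift a to ℕ+ using ha
  lift b to ℕ+ using hb
  have hsum : Summable fun q : ℕ+ × ℕ+ ↦
      if (a * q.1 : ℕ) = b * q.2 then (q.1 : ℂ) ^ (-w) * (q.2 : ℂ) ^ (-z) else 0 := by
    refine Summable.of_norm_bounded ((summable_norm_coprimePow 1 hw).mul_of_nonneg
      (summable_norm_coprimePow 1 hz) (fun _ ↦ norm_nonneg _) (fun _ ↦ norm_nonneg _))
      (fun q ↦ ?_)
    split_ifs
    · simp [coprimePow]
    · rw [norm_zero]; positivity
  have hinj : Function.Injective fun t : ℕ+ ↦ (b * t, a * t) := fun t t' h ↦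
    mul_left_cancel (congrArg Prod.fst h)
  rw [← hsum.tsum_prod, ← hinj.tsum_eq]
  · rw [← tsum_pnat_cpow (by rw [Complex.add_re]; linarith), ← tsum_mul_left]
    refine tsum_congr fun t ↦ ?_
    have ht : (t : ℂ) ≠ 0 := by exact_mod_cast t.ne_zero
    simp only [PNat.mul_coe, Nat.cast_mul, Complex.natCast_mul_natCast_cpow, neg_add,
      Complex.cpow_add _ _ ht]
    rw [if_pos (by ring)]
    ring
  · rintro ⟨m, n⟩ hq
    have h : (a * m : ℕ) = b * n := by
      by_contra h
      exact hq (if_neg h)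
    obtain ⟨t, ht⟩ : (b : ℕ) ∣ m := hab.symm.dvd_of_dvd_mul_left ⟨n, h⟩
    have ht0 : 0 < t := Nat.pos_of_ne_zero (by rintro rfl; simp at ht)
    lift t to ℕ+ using ht0
    refine ⟨t, Prod.ext (PNat.coe_injective ht.symm) (PNat.coe_injective ?_)⟩
    refine Nat.eq_of_mul_eq_mul_left b.pos ?_
    rw [← h, ht, PNat.mul_coe]
    ring

/-- Evaluation of the diagonal sum `J₀`: for coprime positive integers `c, d` and
`Re u, Re v, Re w, Re z > 1`,
`∑_{(ck,dl)=1} k⁻ᵘ l⁻ᵛ ∑_{ckm=dln} m⁻ʷ n⁻ᶻ` equals the stated Euler product expression. -/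
theorem diagonal_sum_eval (c d : ℕ) (hc : 0 < c) (hd : 0 < d) (hcd : Nat.Coprime c d)
    (u v w z : ℂ) (hu : 1 < u.re) (hv : 1 < v.re) (hw : 1 < w.re) (hz : 1 < z.re) :
    (∑' k : ℕ+, ∑' l : ℕ+,
      if Nat.gcd (c * k) (d * l) = 1 then
        (k : ℂ) ^ (-u) * (l : ℂ) ^ (-v) *
          ∑' m : ℕ+, ∑' n : ℕ+,
            (if c * k * m = d * l * n then (m : ℂ) ^ (-w) * (n : ℂ) ^ (-z) else 0)
      else 0)
    = (c : ℂ) ^ (-z) * (d : ℂ) ^ (-w) *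
        riemannZeta (w + z) * riemannZeta (u + z) * riemannZeta (v + w) /
        riemannZeta (u + v + w + z) *
        (∏ p ∈ (c * d).primeFactors, (1 - (p : ℂ) ^ (-(u + v + w + z)))⁻¹) *
        (∏ p ∈ c.primeFactors, (1 - (p : ℂ) ^ (-(v + w)))) *
        (∏ p ∈ d.primeFactors, (1 - (p : ℂ) ^ (-(u + z)))) := by
  have : NeZero c := ⟨hc.ne'⟩
  have : NeZero d := ⟨hd.ne'⟩
  have hs : 1 < (u + z).re := by rw [add_re]; linarith
  have ht : 1 < (v + w).re := by rw [add_re]; linarith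
  have hst : 1 < (u + z + (v + w)).re := by rw [add_re]; linarith
  have hterm (k l : ℕ+) : (if Nat.gcd (c * k) (d * l) = 1 then
        (k : ℂ) ^ (-u) * (l : ℂ) ^ (-v) *
          ∑' m : ℕ+, ∑' n : ℕ+,
            (if c * k * m = d * l * n then (m : ℂ) ^ (-w) * (n : ℂ) ^ (-z) else 0)
      else 0) = (c : ℂ) ^ (-z) * (d : ℂ) ^ (-w) * riemannZeta (w + z) *
        if Nat.Coprime k l then coprimePow d (u + z) k * coprimePow c (v + w) l else 0 := by
    have hcop : Nat.gcd (c * k) (d * l) = 1 ↔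
        Nat.Coprime k l ∧ Nat.Coprime k d ∧ Nat.Coprime l c := by
      change Nat.Coprime _ _ ↔ _
      rw [Nat.coprime_mul_iff_left, Nat.coprime_mul_iff_right, Nat.coprime_mul_iff_right,
        Nat.coprime_comm (m := c) (n := l)]
      tauto
    by_cases h : Nat.gcd (c * k) (d * l) = 1
    · obtain ⟨hkl, hkd, hlc⟩ := hcop.1 h
      have hk : (k : ℂ) ≠ 0 := by exact_mod_cast k.ne_zero
      have hl : (l : ℂ) ≠ 0 := by exact_mod_cast l.ne_zero
      have key := tsum_tsum_of_mul_eq_mul (Nat.mul_pos hc k.pos) (Nat.mul_pos hd l.pos) h hw hz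
      simp only [Nat.cast_mul, Complex.natCast_mul_natCast_cpow] at key
      rw [if_pos h, if_pos hkl, coprimePow, if_pos hkd, coprimePow, if_pos hlc, key, neg_add,
        neg_add, cpow_add _ _ hk, cpow_add _ _ hl]
      ring
    · rw [if_neg h]
      rw [hcop] at h
      simp only [coprimePow]
      split_ifs <;> simp_all
  simp only [hterm, tsum_mul_left]
  rw [← (summable_norm_coprime_pair d c hs ht).of_norm.tsum_prod]
  have key := tsum_coprimePow_mul_tsum_coprimePow d c hs ht
  rw [tsum_coprimePow d hs, tsum_coprimePow c ht, tsum_coprimePow (c * d) hst] at key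
  have hζ := riemannZeta_ne_zero_of_one_lt_re hst
  have hP : ∏ p ∈ (c * d).primeFactors, (1 - (p : ℂ) ^ (-(u + z + (v + w)))) ≠ 0 :=
    Finset.prod_ne_zero_iff.2 fun p hp ↦
      one_sub_prime_cpow_ne_zero (Nat.prime_of_mem_primeFactors hp) hst
  rw [show u + v + w + z = u + z + (v + w) by ring, Finset.prod_inv_distrib]
  field_simp
  linear_combination -(c : ℂ) ^ (-z) * (d : ℂ) ^ (-w) * riemannZeta (w + z) * key
end

section
/- Let q and m be positive integers and let s be a complex number with s ≠ 1. Then ∑_{h = 1, gcd(h,q) = 1}^{q} ζ(s, h·m/q) = ζ(s) · ∑_{δ ∣ q} δ · μ(q/δ) · (δ / gcd(δ, m))^{s−1}, where the sum on the right runs over the positive divisors δ of q. -/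
open Complex HurwitzZeta

theorem ZMod.sum_range_mul_natCast {M : Type*} [AddCommMonoid M] {N : ℕ} [NeZero N]
    (F : ZMod N → M) (g : ℕ) :
    ∑ k ∈ Finset.range (g * N), F k = g • ∑ j, F j := by
  have h_single : ∑ k ∈ Finset.range N, F k = ∑ j, F j := by
    refine Finset.sum_bij' (fun k _ => (k : ZMod N)) (fun j _ => j.val) ?_ ?_ ?_ ?_ ?_
    · simp
    · simpa using fun j => ZMod.val_lt j
    · intro k hk
      exact ZMod.val_cast_of_lt (Finset.mem_range.mp hk)
    · simp
    · simp
  induction g with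
  | zero => simp
  | succ g ih => simp [Nat.succ_mul, Finset.sum_range_add, ih, h_single, succ_nsmul]

theorem ZMod.sum_Icc_mul_natCast {M : Type*} [AddCommMonoid M] {N : ℕ} [NeZero N]
    (F : ZMod N → M) (g : ℕ) :
    ∑ k ∈ Finset.Icc 1 (g * N), F k = g • ∑ j, F j := by
  have h_shift : ∑ k ∈ Finset.Icc 1 (g * N), F k =
      ∑ k ∈ Finset.range (g * N), F ((k : ZMod N) + 1) := by
    rw [Finset.range_eq_Ico, ← Finset.Ico_add_one_right_eq_Icc,
      ← Finset.sum_Ico_add' (fun k : ℕ => F k) 0 (g * N) 1]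
    simp
  rw [h_shift, ZMod.sum_range_mul_natCast (fun j => F (j + 1))]
  exact congrArg (g • ·) (Equiv.sum_comp (Equiv.addRight (1 : ZMod N)) F)

theorem ZMod.LFunction_const_one {N : ℕ} [NeZero N] {s : ℂ} (hs : s ≠ 1) :
    ZMod.LFunction (fun _ : ZMod N => 1) s = riemannZeta s := by
  have h_eq : Set.EqOn (ZMod.LFunction (fun _ : ZMod N => 1)) riemannZeta {1}ᶜ := by
    refine AnalyticOnNhd.eqOn_of_preconnected_of_eventuallyEq (𝕜 := ℂ) (z₀ := 2)
      (DifferentiableOn.analyticOnNhd (fun z hz => ?_) isOpen_compl_singleton)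
      (DifferentiableOn.analyticOnNhd (fun z hz => ?_) isOpen_compl_singleton)
      (isConnected_compl_singleton_of_one_lt_rank (by simp) 1).isPreconnected (by simp) ?_
    · exact (ZMod.differentiableAt_LFunction _ z (.inl hz)).differentiableWithinAt
    · exact (differentiableAt_riemannZeta hz).differentiableWithinAt
    · filter_upwards [(continuous_re.isOpen_preimage _ isOpen_Ioi).mem_nhds
        (show (2 : ℂ) ∈ re ⁻¹' Set.Ioi 1 by simp)] with z hz
      rw [ZMod.LFunction_eq_LSeries _ hz]
      exact LSeries_one_eq_riemannZeta hz
  exact h_eq hs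

/-- The distribution relation for the Hurwitz zeta function at `0`. -/
theorem sum_hurwitzZeta_toAddCircle {N : ℕ} [NeZero N] {s : ℂ} (hs : s ≠ 1) :
    ∑ j : ZMod N, hurwitzZeta (ZMod.toAddCircle j) s = (N : ℂ) ^ s * riemannZeta s := by
  have hN : (N : ℂ) ≠ 0 := NeZero.ne _
  rw [← ZMod.LFunction_const_one (N := N) hs, ZMod.LFunction, ← mul_assoc, ← cpow_add _ _ hN]
  simp

theorem sum_hurwitzZeta_mul_div {n m : ℕ} (hn : 0 < n) {s : ℂ} (hs : s ≠ 1) :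
    ∑ k ∈ Finset.Icc 1 n, hurwitzZeta (((k * m : ℕ) / (n : ℝ) : ℝ) : UnitAddCircle) s =
      n * ((n : ℂ) / (Nat.gcd n m : ℂ)) ^ (s - 1) * riemannZeta s := by
  obtain ⟨g, N, r, hg, hcop, hN, hr⟩ := Nat.exists_coprime' (Nat.gcd_pos_of_pos_left m hn)
  have hgcd : Nat.gcd n m = g := by
    rw [hN, hr, Nat.gcd_mul_right, hcop.gcd_eq_one, one_mul]
  have hN_pos : 0 < N := Nat.pos_of_ne_zero fun h => by simp [h] at hN; omega
  have : NeZero N := ⟨hN_pos.ne'⟩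
  have hg_ne : (g : ℂ) ≠ 0 := by exact_mod_cast hg.ne'
  have hN_ne : (N : ℂ) ≠ 0 := by exact_mod_cast hN_pos.ne'
  have h_term (k : ℕ) : (((k * m : ℕ) / (n : ℝ) : ℝ) : UnitAddCircle) =
      ZMod.toAddCircle ((k : ZMod N) * (ZMod.unitOfCoprime r hcop.symm : ZMod N)) := by
    rw [ZMod.coe_unitOfCoprime, ← Nat.cast_mul, ZMod.toAddCircle_natCast, hN, hr]
    congr 1
    have hg' : (g : ℝ) ≠ 0 := by exact_mod_cast hg.ne'
    push_cast
    field_simp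
  simp_rw [h_term]
  have h_sum := ZMod.sum_Icc_mul_natCast (fun j : ZMod N =>
    hurwitzZeta (ZMod.toAddCircle (j * (ZMod.unitOfCoprime r hcop.symm : ZMod N))) s) g
  rw [mul_comm g N, ← hN] at h_sum
  have h_perm := Equiv.sum_comp (Units.mulRight (ZMod.unitOfCoprime r hcop.symm))
    (fun j : ZMod N => hurwitzZeta (ZMod.toAddCircle j) s)
  simp only [Units.mulRight_apply] at h_perm
  rw [h_sum, h_perm, sum_hurwitzZeta_toAddCircle hs,
    hgcd, hN, Nat.cast_mul, mul_div_cancel_right₀ _ hg_ne, cpow_sub _ _ hN_ne, cpow_one,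
    nsmul_eq_mul]
  field_simp

theorem sum_divisors_filter_dvd_moebius {q : ℕ} (hq : q ≠ 0) (h : ℕ) :
    ∑ d ∈ q.divisors with d ∣ h, ArithmeticFunction.moebius d =
      if Nat.gcd h q = 1 then 1 else 0 := by
  have h_divisors : q.divisors.filter (· ∣ h) = (Nat.gcd h q).divisors := by
    ext d
    simp [Nat.dvd_gcd_iff, hq, and_comm]
  rw [h_divisors, ← ArithmeticFunction.coe_zeta_mul_apply,
    ArithmeticFunction.coe_zeta_mul_moebius, ArithmeticFunction.one_apply]

theorem sum_Icc_filter_dvd {M : Type*} [AddCommMonoid M] {e : ℕ} (he : 0 < e) (n : ℕ)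
    (f : ℕ → M) :
    ∑ h ∈ Finset.Icc 1 (n * e) with e ∣ h, f h = ∑ k ∈ Finset.Icc 1 n, f (k * e) := by
  symm
  refine Finset.sum_bij' (fun k _ => k * e) (fun h _ => h / e) ?_ ?_ ?_ ?_ ?_
  · intro k hk
    rw [Finset.mem_Icc] at hk
    exact Finset.mem_filter.mpr ⟨Finset.mem_Icc.mpr ⟨Nat.mul_pos hk.1 he,
      Nat.mul_le_mul_right e hk.2⟩, Nat.dvd_mul_left e k⟩
  · intro h hh
    simp only [Finset.mem_filter, Finset.mem_Icc] at hh ⊢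
    exact ⟨Nat.div_pos (Nat.le_of_dvd hh.1.1 hh.2) he, Nat.div_le_of_le_mul (by linarith [hh.1.2])⟩
  · intro k _
    exact Nat.mul_div_cancel k he
  · intro h hh
    exact Nat.div_mul_cancel (Finset.mem_filter.mp hh).2
  · simp

theorem sum_coprime_eq_sum_moebius {R : Type*} [Ring R] {q : ℕ} (hq : 0 < q) (f : ℕ → R) :
    ∑ h ∈ Finset.Icc 1 q with Nat.gcd h q = 1, f h =
      ∑ d ∈ q.divisors, (ArithmeticFunction.moebius (q / d) : R) *
        ∑ k ∈ Finset.Icc 1 d, f (k * (q / d)) := by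
  have h_inner : ∀ e ∈ q.divisors, ∑ k ∈ Finset.Icc 1 (q / e), f (k * e) =
      ∑ h ∈ Finset.Icc 1 q with e ∣ h, f h := by
    intro e he
    rw [← sum_Icc_filter_dvd (Nat.pos_of_mem_divisors he),
      Nat.div_mul_cancel (Nat.dvd_of_mem_divisors he)]
  calc ∑ h ∈ Finset.Icc 1 q with Nat.gcd h q = 1, f h
      = ∑ h ∈ Finset.Icc 1 q, ∑ e ∈ q.divisors,
          if e ∣ h then (ArithmeticFunction.moebius e : R) * f h else 0 := by
        rw [Finset.sum_filter]
        refine Finset.sum_congr rfl fun h _ => ?_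
        rw [← Finset.sum_filter, ← Finset.sum_mul, ← Int.cast_sum,
          sum_divisors_filter_dvd_moebius hq.ne']
        split_ifs <;> simp
    _ = ∑ e ∈ q.divisors, (ArithmeticFunction.moebius e : R) *
          ∑ k ∈ Finset.Icc 1 (q / e), f (k * e) := by
        rw [Finset.sum_comm]
        refine Finset.sum_congr rfl fun e he => ?_
        rw [h_inner e he, ← Finset.sum_filter, Finset.mul_sum]
    _ = _ := by
        rw [← Nat.sum_div_divisors q]
        refine Finset.sum_congr rfl fun d hd => ?_
        rw [Nat.div_div_self (Nat.dvd_of_mem_divisors hd) hq.ne']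

/-- Evaluation of a coprime-restricted sum of Hurwitz zeta values:
`∑_{h ≤ q, (h,q)=1} ζ(s, hm/q) = ζ(s) ∑_{δ ∣ q} δ μ(q/δ) (δ/(δ,m))^{s-1}`. -/
theorem sum_hurwitzZeta_coprime (q m : ℕ) (hq : 0 < q) (hm : 0 < m)
    (s : ℂ) (hs : s ≠ 1) :
    (∑ h ∈ (Finset.Icc 1 q).filter (fun h => Nat.gcd h q = 1),
        hurwitzZeta (((h * m : ℕ) / (q : ℝ) : ℝ) : UnitAddCircle) s)
    = riemannZeta s *
        ∑ δ ∈ q.divisors,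
          (δ : ℂ) * (ArithmeticFunction.moebius (q / δ) : ℂ) *
            ((δ : ℂ) / (Nat.gcd δ m : ℂ)) ^ (s - 1) := by
  rw [sum_coprime_eq_sum_moebius hq, Finset.mul_sum]
  refine Finset.sum_congr rfl fun δ hδ => ?_
  have hδ_pos := Nat.pos_of_mem_divisors hδ
  have h_term (k : ℕ) : (((k * (q / δ) * m : ℕ) / (q : ℝ) : ℝ) : UnitAddCircle) =
      (((k * m : ℕ) / (δ : ℝ) : ℝ) : UnitAddCircle) := by
    obtain ⟨e, rfl⟩ := Nat.dvd_of_mem_divisors hδ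
    have he : (e : ℝ) ≠ 0 := by
      exact_mod_cast (Nat.pos_of_mul_pos_left hq).ne'
    have hδ' : (δ : ℝ) ≠ 0 := by exact_mod_cast hδ_pos.ne'
    rw [Nat.mul_div_cancel_left e hδ_pos]
    congr 1
    push_cast
    field_simp
  simp_rw [h_term]
  rw [sum_hurwitzZeta_mul_div hδ_pos hs]
  ring
end

section
/- Let δ be a positive integer, α a complex number, and s a complex number with Re s > max(1, Re α + 1). Then ∑_{f = 1}^{∞} gcd(f, δ)^{α} · f^{−s} = ζ(s) · ∑_{λ ∣ δ} λ^{α − s} · ∏_{p ∣ λ} (1 − p^{−α}), where λ runs over the positive divisors of δ and p over primes. -/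
open Complex

/-- A completely multiplicative power is recovered by summing over divisors its difference along
each prime. -/
lemma sum_divisors_cpow_mul_prod_primeFactors (α : ℂ) {n : ℕ} (hn : n ≠ 0) :
    ∑ l ∈ n.divisors, (l : ℂ) ^ α * ∏ p ∈ l.primeFactors, (1 - (p : ℂ) ^ (-α)) =
      (n : ℂ) ^ α := by
  induction n using Nat.recOnPosPrimePosCoprime with
  | zero => exact absurd rfl hn
  | one => simp
  | prime_pow p k hp hk =>
    clear hn hk
    have hp0 : (p : ℂ) ≠ 0 := by exact_mod_cast hp.ne_zero
    rw [Nat.sum_divisors_prime_pow hp]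
    induction k with
    | zero => simp
    | succ k ih =>
      have hpow : ((p ^ (k + 1) : ℕ) : ℂ) ^ α = ((p ^ k : ℕ) : ℂ) ^ α * (p : ℂ) ^ α := by
        rw [pow_succ, Nat.cast_mul, natCast_mul_natCast_cpow]
      rw [Finset.sum_range_succ, ih, Nat.primeFactors_prime_pow k.succ_ne_zero hp,
        Finset.prod_singleton, hpow, cpow_neg]
      have hpα : (p : ℂ) ^ α ≠ 0 := by simp [cpow_eq_zero_iff, hp0]
      field_simp
      ring
  | coprime a b ha hb hab iha ihb =>
    rw [Nat.cast_mul, natCast_mul_natCast_cpow, ← iha (by lia), ← ihb (by lia),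
      Finset.sum_mul_sum, ← Finset.sum_product', Nat.divisors_mul, Finset.mul_def,
      Finset.sum_image hab.mul_injOn_divisors]
    refine Finset.sum_congr rfl fun x hx ↦ ?_
    obtain ⟨hxa, hxb⟩ := Finset.mem_product.mp hx
    have hx' : x.1.Coprime x.2 :=
      hab.of_dvd (Nat.dvd_of_mem_divisors hxa) (Nat.dvd_of_mem_divisors hxb)
    rw [Nat.cast_mul, natCast_mul_natCast_cpow, hx'.primeFactors_mul,
      Finset.prod_union hx'.disjoint_primeFactors]
    ring

/-- The Dirichlet series of the indicator function of the positive multiples of `l`. -/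
lemma hasSum_ite_dvd_cpow_neg {s : ℂ} (hs : 1 < s.re) {l : ℕ} (hl : 0 < l) :
    HasSum (fun f : ℕ+ ↦ if l ∣ f then ((f : ℕ) : ℂ) ^ (-s) else 0)
      ((l : ℂ) ^ (-s) * riemannZeta s) := by
  have hzeta : HasSum (fun m : ℕ+ ↦ ((m : ℕ) : ℂ) ^ (-s)) (riemannZeta s) := by
    have hs0 : s ≠ 0 := by rintro rfl; norm_num at hs
    rw [hasSum_pnat_iff (f := fun m : ℕ ↦ (m : ℂ) ^ (-s)), Nat.cast_zero,
      zero_cpow (neg_ne_zero.mpr hs0), add_zero, zeta_eq_tsum_one_div_nat_cpow hs]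
    simpa only [cpow_neg, one_div] using (summable_one_div_nat_cpow.mpr hs).hasSum
  lift l to ℕ+ using hl
  have hinj : Function.Injective fun m : ℕ+ ↦ l * m := mul_right_injective l
  rw [← hinj.hasSum_iff]
  · convert! hzeta.mul_left _ using 2 with m
    simp [natCast_mul_natCast_cpow]
  · intro f hf
    refine if_neg fun h ↦ hf ?_
    obtain ⟨m, rfl⟩ := PNat.dvd_iff.mpr h
    exact ⟨m, rfl⟩

/-- Evaluation of `∑_f gcd(f,δ)^α f^{-s}` as a zeta value times a finite Euler-type sum over
the divisors of `δ`. -/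
theorem gcd_power_dirichlet_series (δ : ℕ) (hδ : 0 < δ) (α s : ℂ)
    (hs : max 1 (α.re + 1) < s.re) :
    (∑' f : ℕ+, (Nat.gcd f δ : ℂ) ^ α * (f : ℂ) ^ (-s))
    = riemannZeta s *
        ∑ l ∈ δ.divisors, (l : ℂ) ^ (α - s) *
          ∏ p ∈ l.primeFactors, (1 - (p : ℂ) ^ (-α)) := by
  have hs1 : 1 < s.re := (le_max_left _ _).trans_lt hs
  refine HasSum.tsum_eq ?_
  have key := hasSum_sum (s := δ.divisors) fun l hl ↦
    (hasSum_ite_dvd_cpow_neg hs1 (Nat.pos_of_mem_divisors hl)).mul_left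
      ((l : ℂ) ^ α * ∏ p ∈ l.primeFactors, (1 - (p : ℂ) ^ (-α)))
  convert! key using 1
  · ext f
    rw [← sum_divisors_cpow_mul_prod_primeFactors α (Nat.gcd_pos_of_pos_right _ hδ).ne',
      Finset.sum_mul]
    simp only [mul_ite, mul_zero]
    rw [← Finset.sum_filter]
    refine Finset.sum_congr ?_ fun _ _ ↦ rfl
    ext l
    simp [Nat.dvd_gcd_iff, hδ.ne', and_comm]
  · rw [Finset.mul_sum]
    refine Finset.sum_congr rfl fun l hl ↦ ?_
    have hl0 : (l : ℂ) ≠ 0 := by exact_mod_cast (Nat.pos_of_mem_divisors hl).ne'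
    rw [sub_eq_add_neg, cpow_add _ _ hl0]
    ring
end

section
/- Let N be a positive integer, D an integer with gcd(D, N) = 1, and let α, β, s be complex numbers with Re α < 0, Re β < 0 and Re s > 1. Then ∑_{f = 1}^{∞} f^{−s} ∑_{h = 1, gcd(h,N) = 1}^{N} ζ(α, h/N) · ζ(β, −(D h)^{*} f / N) = 2 Γ(1−α) Γ(1−β) (2π)^{α+β−2} ∑_{m,n = 1}^{∞} m^{α−1} n^{−s} σ_{β+s−1}(n) · [ cos(π(α−β)/2) · S(m, D^{*} n; N) − cos(π(α+β)/2) · S(m, −D^{*} n; N) ], where (Dh)^{*} denotes any integer inverse of D·h modulo N and D^{*} any integer inverse of D modulo N. -/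
open Complex HurwitzZeta

/-- The generalized divisor function `σ_α(n) = ∑_{d ∣ n} d^α` with complex exponent. -/
noncomputable def sigmaC (α : ℂ) (n : ℕ) : ℂ := ∑ d ∈ n.divisors, (d : ℂ) ^ α

/-- The Kloosterman sum `S(m,n;N) = ∑_{x mod N, (x,N)=1} e(（m x + n x̄)/N)`. -/
noncomputable def kloostermanSum (N : ℕ) [NeZero N] (m n : ZMod N) : ℂ :=
  ∑ x : (ZMod N)ˣ,
    Complex.exp (2 * Real.pi * Complex.I *
      (((m * (x : ZMod N)).val : ℂ) + ((n * ((x⁻¹ : (ZMod N)ˣ) : ZMod N)).val : ℂ)) / N)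
lemma kloostermanSum_eq_sum_stdAddChar (N : ℕ) [NeZero N] (m n : ZMod N) :
    kloostermanSum N m n =
      ∑ x : (ZMod N)ˣ, ZMod.stdAddChar (m * (x : ZMod N) + n * ((x⁻¹ : (ZMod N)ˣ) : ZMod N)) := by
  refine Finset.sum_congr rfl fun x _ ↦ ?_
  rw [AddChar.map_add_eq_mul, ZMod.stdAddChar_apply, ZMod.stdAddChar_apply, ZMod.toCircle_apply,
    ZMod.toCircle_apply, ← Complex.exp_add]
  congr 1
  ring

lemma PNat.summable_norm_natCast_cpow {a : ℂ} (ha : a.re < -1) :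
    Summable fun m : ℕ+ ↦ ‖((m : ℕ) : ℂ) ^ a‖ := by
  refine ((Real.summable_nat_rpow.mpr ha).comp_injective PNat.coe_injective).congr fun m ↦ ?_
  simp [Complex.norm_natCast_cpow_of_pos m.pos]

lemma hasSum_expZeta_toAddCircle {N : ℕ} [NeZero N] (x : ZMod N) {a : ℂ} (ha : 1 < a.re) :
    HasSum (fun m : ℕ+ ↦ ZMod.stdAddChar (x * ((m : ℕ) : ZMod N)) * ((m : ℕ) : ℂ) ^ (-a))
      (expZeta (ZMod.toAddCircle x) a) := by
  have h := hasSum_expZeta_of_one_lt_re (x.val / N : ℝ) ha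
  rw [← ZMod.toAddCircle_apply] at h
  have ha0 : a ≠ 0 := by rintro rfl; norm_num at ha
  rw [← Function.Injective.hasSum_iff PNat.coe_injective] at h
  · refine h.congr_fun fun m ↦ ?_
    have : x * ((m : ℕ) : ZMod N) = ((x.val * m : ℤ) : ZMod N) := by simp
    rw [this, ZMod.stdAddChar_coe]
    simp only [Function.comp_apply, Complex.cpow_neg, div_eq_mul_inv]
    push_cast
    congr 2
    ring
  · intro m hm
    have : m = 0 := by
      by_contra h0
      exact hm ⟨⟨m, Nat.pos_of_ne_zero h0⟩, rfl⟩
    simp [this, Complex.zero_cpow ha0]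

lemma summable_norm_stdAddChar_mul_cpow {N : ℕ} [NeZero N] (x : ZMod N) {a : ℂ}
    (ha : 1 < a.re) : Summable fun m : ℕ+ ↦
      ‖ZMod.stdAddChar (x * ((m : ℕ) : ZMod N)) * ((m : ℕ) : ℂ) ^ (-a)‖ := by
  refine (PNat.summable_norm_natCast_cpow (a := -a) ?_).congr fun m ↦ ?_
  · rw [Complex.neg_re]
    linarith
  · rw [norm_mul, ZMod.stdAddChar_apply, Circle.norm_coe, one_mul]

lemma hasSum_expZeta_mul_expZeta {N : ℕ} [NeZero N] (x y : ZMod N) {a b : ℂ}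
    (ha : 1 < a.re) (hb : 1 < b.re) :
    HasSum (fun p : ℕ+ × ℕ+ ↦ ((p.1 : ℕ) : ℂ) ^ (-a) * ((p.2 : ℕ) : ℂ) ^ (-b) *
        ZMod.stdAddChar (x * ((p.1 : ℕ) : ZMod N) + y * ((p.2 : ℕ) : ZMod N)))
      (expZeta (ZMod.toAddCircle x) a * expZeta (ZMod.toAddCircle y) b) := by
  have hsum := summable_mul_of_summable_norm (summable_norm_stdAddChar_mul_cpow x ha)
    (summable_norm_stdAddChar_mul_cpow y hb)
  have h := (hasSum_expZeta_toAddCircle x ha).mul (hasSum_expZeta_toAddCircle y hb) hsum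
  refine h.congr_fun fun p ↦ ?_
  rw [AddChar.map_add_eq_mul]
  ring

lemma hasSum_sum_units_expZeta_mul_expZeta {N : ℕ} [NeZero N] (u v : ZMod N) {a b : ℂ}
    (ha : 1 < a.re) (hb : 1 < b.re) :
    HasSum (fun p : ℕ+ × ℕ+ ↦ ((p.1 : ℕ) : ℂ) ^ (-a) * ((p.2 : ℕ) : ℂ) ^ (-b) *
        kloostermanSum N (u * ((p.1 : ℕ) : ZMod N)) (v * ((p.2 : ℕ) : ZMod N)))
      (∑ x : (ZMod N)ˣ, expZeta (ZMod.toAddCircle (u * (x : ZMod N))) a *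
        expZeta (ZMod.toAddCircle (v * ((x⁻¹ : (ZMod N)ˣ) : ZMod N))) b) := by
  refine (hasSum_sum fun x _ ↦ hasSum_expZeta_mul_expZeta _ _ ha hb).congr_fun fun p ↦ ?_
  rw [kloostermanSum_eq_sum_stdAddChar, Finset.mul_sum]
  refine Finset.sum_congr rfl fun x _ ↦ ?_
  congr 2
  ring

lemma hurwitzZeta_eq_expZeta (t : UnitAddCircle) {α : ℂ} (hα : α.re < 0) :
    hurwitzZeta t α = (2 * (Real.pi : ℂ)) ^ (-(1 - α)) * Complex.Gamma (1 - α) *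
      (exp (-Real.pi * I * (1 - α) / 2) * expZeta t (1 - α) +
        exp (Real.pi * I * (1 - α) / 2) * expZeta (-t) (1 - α)) := by
  rw [← hurwitzZeta_one_sub t, sub_sub_cancel]
  · intro n h
    have := congrArg Complex.re h
    simp at this
    have : (0 : ℝ) ≤ n := n.cast_nonneg
    linarith
  · right
    intro h
    have := congrArg Complex.re h
    simp at this
    linarith

/-- The combination of Kloosterman sums attached to the product of two Hurwitz zeta values. -/
noncomputable def kloostermanComb (N : ℕ) [NeZero N] (α β : ℂ) (m n : ZMod N) : ℂ :=
  Complex.cos ((Real.pi : ℂ) * (α - β) / 2) * kloostermanSum N m n -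
    Complex.cos ((Real.pi : ℂ) * (α + β) / 2) * kloostermanSum N m (-n)

lemma exists_norm_kloostermanComb_le (N : ℕ) [NeZero N] (α β : ℂ) :
    ∃ C, ∀ m n : ZMod N, ‖kloostermanComb N α β m n‖ ≤ C := by
  obtain ⟨C, hC⟩ := (Set.finite_range fun p : ZMod N × ZMod N ↦
    ‖kloostermanComb N α β p.1 p.2‖).bddAbove
  exact ⟨C, fun m n ↦ hC ⟨(m, n), rfl⟩⟩

lemma sum_units_hurwitzZeta_mul_hurwitzZeta {N : ℕ} [NeZero N] (v : ZMod N) {α β : ℂ}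
    (hα : α.re < 0) (hβ : β.re < 0) :
    ∑ x : (ZMod N)ˣ, hurwitzZeta (ZMod.toAddCircle (x : ZMod N)) α *
        hurwitzZeta (-ZMod.toAddCircle (v * ((x⁻¹ : (ZMod N)ˣ) : ZMod N))) β =
      2 * Complex.Gamma (1 - α) * Complex.Gamma (1 - β) * (2 * (Real.pi : ℂ)) ^ (α + β - 2) *
        ∑' p : ℕ+ × ℕ+, ((p.1 : ℕ) : ℂ) ^ (α - 1) * ((p.2 : ℕ) : ℂ) ^ (β - 1) *
          kloostermanComb N α β ((p.1 : ℕ) : ZMod N) (v * ((p.2 : ℕ) : ZMod N)) := by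
  have ha : 1 < (1 - α).re := by rw [Complex.sub_re, Complex.one_re]; linarith
  have hb : 1 < (1 - β).re := by rw [Complex.sub_re, Complex.one_re]; linarith
  have h1 := hasSum_sum_units_expZeta_mul_expZeta (N := N) 1 v ha hb
  have h2 := hasSum_sum_units_expZeta_mul_expZeta (N := N) 1 (-v) ha hb
  have hflip (w : ZMod N) : ∑ x : (ZMod N)ˣ, expZeta (-ZMod.toAddCircle (x : ZMod N)) (1 - α) *
        expZeta (ZMod.toAddCircle (w * ((x⁻¹ : (ZMod N)ˣ) : ZMod N))) (1 - β) =
      ∑ x : (ZMod N)ˣ, expZeta (ZMod.toAddCircle (x : ZMod N)) (1 - α) *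
        expZeta (-ZMod.toAddCircle (w * ((x⁻¹ : (ZMod N)ˣ) : ZMod N))) (1 - β) := by
    rw [← Equiv.sum_comp (Equiv.neg (ZMod N)ˣ)]
    simp
  have h3 := hflip v
  have h4 := hflip (-v)
  simp only [neg_sub, one_mul, neg_mul, map_neg, neg_neg] at h1 h2 h3 h4
  have hsum : ∑' p : ℕ+ × ℕ+, ((p.1 : ℕ) : ℂ) ^ (α - 1) * ((p.2 : ℕ) : ℂ) ^ (β - 1) *
        kloostermanComb N α β ((p.1 : ℕ) : ZMod N) (v * ((p.2 : ℕ) : ZMod N)) = _ :=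
    (((h1.mul_left (Complex.cos ((Real.pi : ℂ) * (α - β) / 2))).sub
      (h2.mul_left (Complex.cos ((Real.pi : ℂ) * (α + β) / 2)))).congr_fun fun p ↦ by
        rw [kloostermanComb]; ring).tsum_eq
  rw [hsum]
  have hpi : (2 * (Real.pi : ℂ)) ^ (α + β - 2) =
      (2 * (Real.pi : ℂ)) ^ (-(1 - α)) * (2 * (Real.pi : ℂ)) ^ (-(1 - β)) := by
    rw [← Complex.cpow_add _ _ (by simp [Real.pi_ne_zero])]
    congr 1
    ring
  have hc1 : 2 * Complex.cos ((Real.pi : ℂ) * (α - β) / 2) =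
      exp (-Real.pi * I * (1 - α) / 2) * exp (Real.pi * I * (1 - β) / 2) +
      exp (Real.pi * I * (1 - α) / 2) * exp (-Real.pi * I * (1 - β) / 2) := by
    rw [Complex.two_cos, ← Complex.exp_add, ← Complex.exp_add]
    congr 2 <;> ring
  have hc2 : -(2 * Complex.cos ((Real.pi : ℂ) * (α + β) / 2)) =
      exp (-Real.pi * I * (1 - α) / 2) * exp (-Real.pi * I * (1 - β) / 2) +
      exp (Real.pi * I * (1 - α) / 2) * exp (Real.pi * I * (1 - β) / 2) := by
    rw [← mul_neg, ← Complex.cos_sub_pi, Complex.two_cos, ← Complex.exp_add, ← Complex.exp_add]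
    congr 2 <;> ring
  have hterm (x : (ZMod N)ˣ) : hurwitzZeta (ZMod.toAddCircle (x : ZMod N)) α *
        hurwitzZeta (-ZMod.toAddCircle (v * ((x⁻¹ : (ZMod N)ˣ) : ZMod N))) β =
      (2 * (Real.pi : ℂ)) ^ (-(1 - α)) * (2 * (Real.pi : ℂ)) ^ (-(1 - β)) *
        Complex.Gamma (1 - α) * Complex.Gamma (1 - β) *
      (exp (-Real.pi * I * (1 - α) / 2) * exp (Real.pi * I * (1 - β) / 2) *
        (expZeta (ZMod.toAddCircle (x : ZMod N)) (1 - α) *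
          expZeta (ZMod.toAddCircle (v * ((x⁻¹ : (ZMod N)ˣ) : ZMod N))) (1 - β)) +
      exp (Real.pi * I * (1 - α) / 2) * exp (-Real.pi * I * (1 - β) / 2) *
        (expZeta (-ZMod.toAddCircle (x : ZMod N)) (1 - α) *
          expZeta (-ZMod.toAddCircle (v * ((x⁻¹ : (ZMod N)ˣ) : ZMod N))) (1 - β)) +
      exp (-Real.pi * I * (1 - α) / 2) * exp (-Real.pi * I * (1 - β) / 2) *
        (expZeta (ZMod.toAddCircle (x : ZMod N)) (1 - α) *
          expZeta (-ZMod.toAddCircle (v * ((x⁻¹ : (ZMod N)ˣ) : ZMod N))) (1 - β)) +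
      exp (Real.pi * I * (1 - α) / 2) * exp (Real.pi * I * (1 - β) / 2) *
        (expZeta (-ZMod.toAddCircle (x : ZMod N)) (1 - α) *
          expZeta (ZMod.toAddCircle (v * ((x⁻¹ : (ZMod N)ˣ) : ZMod N))) (1 - β))) := by
    rw [hurwitzZeta_eq_expZeta _ hα, hurwitzZeta_eq_expZeta _ hβ, neg_neg]
    ring
  rw [Finset.sum_congr rfl fun x _ ↦ hterm x, ← Finset.mul_sum]
  simp only [Finset.sum_add_distrib, ← Finset.mul_sum]
  rw [h3, h4, hpi]
  linear_combination (-1) * (2 * (Real.pi : ℂ)) ^ (-(1 - α)) * (2 * (Real.pi : ℂ)) ^ (-(1 - β)) *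
        Complex.Gamma (1 - α) * Complex.Gamma (1 - β) *
    (hc1 * (∑ x : (ZMod N)ˣ, expZeta (ZMod.toAddCircle (x : ZMod N)) (1 - α) *
          expZeta (ZMod.toAddCircle (v * ((x⁻¹ : (ZMod N)ˣ) : ZMod N))) (1 - β)) +
     hc2 * (∑ x : (ZMod N)ˣ, expZeta (ZMod.toAddCircle (x : ZMod N)) (1 - α) *
          expZeta (-ZMod.toAddCircle (v * ((x⁻¹ : (ZMod N)ˣ) : ZMod N))) (1 - β)))

lemma sum_filter_coprime_eq_sum_units (N : ℕ) [NeZero N] (F : ZMod N → ℂ) :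
    ∑ h ∈ (Finset.Icc 1 N).filter (fun h => Nat.gcd h N = 1), F (h : ZMod N) =
      ∑ x : (ZMod N)ˣ, F x := by
  have hN := NeZero.pos N
  refine Finset.sum_bij (fun h hh ↦ ZMod.unitOfCoprime h (Finset.mem_filter.mp hh).2)
    (fun _ _ ↦ Finset.mem_univ _) ?_ ?_ (fun _ _ ↦ rfl)
  · intro a ha b hb hab
    have hab' : (a : ZMod N) = b := congrArg Units.val hab
    rw [ZMod.natCast_eq_natCast_iff] at hab'
    simp only [Finset.mem_filter, Finset.mem_Icc] at ha hb
    by_contra hne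
    have h1 := (Nat.modEq_iff_dvd.mp hab')
    have h2 := Int.eq_zero_of_abs_lt_dvd h1 (by rw [abs_lt]; omega)
    omega
  · intro x _
    have hx := ZMod.val_coe_unit_coprime x
    have hlt := ZMod.val_lt (x : ZMod N)
    rcases Nat.eq_zero_or_pos (x : ZMod N).val with h0 | h0
    · rw [h0, Nat.coprime_zero_left] at hx
      subst hx
      exact ⟨1, by simp, Subsingleton.elim _ _⟩
    · refine ⟨(x : ZMod N).val,
        Finset.mem_filter.mpr ⟨Finset.mem_Icc.mpr ⟨h0, hlt.le⟩, hx⟩, ?_⟩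
      ext
      simp

lemma summable_cpow_mul_bounded {s a b : ℂ} (hs : 1 < s.re) (ha : a.re < -1) (hb : b.re < -1)
    {W : ℕ+ × (ℕ+ × ℕ+) → ℂ} {C : ℝ} (hW : ∀ p, ‖W p‖ ≤ C) :
    Summable fun p : ℕ+ × (ℕ+ × ℕ+) ↦ ((p.1 : ℕ) : ℂ) ^ a *
      (((p.2.1 : ℕ) : ℂ) ^ (-s) * ((p.2.2 : ℕ) : ℂ) ^ b) * W p := by
  have h := ((PNat.summable_norm_natCast_cpow ha).mul_of_nonneg
    ((PNat.summable_norm_natCast_cpow (a := -s) (by simpa using hs)).mul_of_nonneg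
      (PNat.summable_norm_natCast_cpow hb) (fun _ ↦ norm_nonneg _) (fun _ ↦ norm_nonneg _))
    (fun _ ↦ norm_nonneg _) (fun _ ↦ by positivity)).mul_right C
  refine .of_norm_bounded h fun p ↦ ?_
  rw [norm_mul, norm_mul, norm_mul]
  gcongr
  exact hW p

lemma tsum_cpow_mul_eq_tsum_sigmaC {s b : ℂ} {w : ℕ → ℂ}
    (h : Summable fun p : ℕ+ × ℕ+ ↦ ((p.1 : ℕ) : ℂ) ^ (-s) * ((p.2 : ℕ) : ℂ) ^ (b - 1) *
      w (p.1 * p.2)) :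
    ∑' p : ℕ+ × ℕ+, ((p.1 : ℕ) : ℂ) ^ (-s) * ((p.2 : ℕ) : ℂ) ^ (b - 1) * w (p.1 * p.2) =
      ∑' n : ℕ+, ((n : ℕ) : ℂ) ^ (-s) * sigmaC (b + s - 1) n * w n := by
  have h' := sigmaAntidiagonalEquivProd.summable_iff.mpr h
  rw [Function.comp_def] at h'
  rw [← sigmaAntidiagonalEquivProd.tsum_eq, h'.tsum_sigma]
  refine tsum_congr fun n ↦ ?_
  simp only [sigmaAntidiagonalEquivProd, divisorsAntidiagonalFactors, Equiv.coe_fn_mk, PNat.mk_coe]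
  rw [tsum_fintype, Finset.univ_eq_attach, (n : ℕ).divisorsAntidiagonal.sum_attach
    fun x : ℕ × ℕ ↦ ((x.1 : ℕ) : ℂ) ^ (-s) * ((x.2 : ℕ) : ℂ) ^ (b - 1) * w (x.1 * x.2),
    Nat.sum_divisorsAntidiagonal' fun x y : ℕ ↦ (x : ℂ) ^ (-s) * (y : ℂ) ^ (b - 1) * w (x * y),
    sigmaC, Finset.mul_sum, Finset.sum_mul]
  refine Finset.sum_congr rfl fun d hd ↦ ?_
  have hdn := Nat.dvd_of_mem_divisors hd
  have hd0 : (d : ℂ) ≠ 0 := by exact_mod_cast (Nat.pos_of_mem_divisors hd).ne'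
  obtain ⟨e, he⟩ := hdn
  have hde : (n : ℕ) / d = e := by rw [he, Nat.mul_div_cancel_left _ (Nat.pos_of_mem_divisors hd)]
  rw [hde]
  rw [he, mul_comm e d, Nat.cast_mul, Complex.natCast_mul_natCast_cpow,
    show b + s - 1 = (b - 1) + s by ring, Complex.cpow_add _ _ hd0, Complex.cpow_neg (d : ℂ)]
  have hds : (d : ℂ) ^ s ≠ 0 := by simp [Complex.cpow_eq_zero_iff, hd0]
  field_simp

/-- Voronoi-type evaluation of a bilinear sum of Hurwitz zeta values in terms of
Kloosterman sums. -/
theorem hurwitz_sum_eq_kloosterman_expansion (N : ℕ) [NeZero N] (D : ℤ)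
    (hD : Int.gcd D N = 1) (α β s : ℂ) (hα : α.re < 0) (hβ : β.re < 0) (hs : 1 < s.re) :
    (∑' f : ℕ+, (f : ℂ) ^ (-s) *
      ∑ h ∈ (Finset.Icc 1 N).filter (fun h => Nat.gcd h N = 1),
        hurwitzZeta (((h : ℝ) / (N : ℝ) : ℝ) : UnitAddCircle) α *
          hurwitzZeta
            ((-(((((D : ZMod N) * (h : ZMod N))⁻¹).val * (f : ℕ) : ℕ) : ℝ) / (N : ℝ) : ℝ) :
              UnitAddCircle) β)
    = 2 * Complex.Gamma (1 - α) * Complex.Gamma (1 - β) *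
        (2 * (Real.pi : ℂ)) ^ (α + β - 2) *
        ∑' m : ℕ+, ∑' n : ℕ+,
          (m : ℂ) ^ (α - 1) * (n : ℂ) ^ (-s) * sigmaC (β + s - 1) n *
            (Complex.cos ((Real.pi : ℂ) * (α - β) / 2) *
                kloostermanSum N ((m : ℕ) : ZMod N) ((D : ZMod N)⁻¹ * ((n : ℕ) : ZMod N)) -
              Complex.cos ((Real.pi : ℂ) * (α + β) / 2) *
                kloostermanSum N ((m : ℕ) : ZMod N)
                  (-((D : ZMod N)⁻¹ * ((n : ℕ) : ZMod N)))) := by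
  obtain ⟨D', hD'⟩ := (ZMod.coe_int_isUnit_iff_isCoprime D N).mpr
    (Int.isCoprime_iff_gcd_eq_one.mpr hD).symm
  have hinner (f : ℕ+) : (f : ℂ) ^ (-s) *
      ∑ h ∈ (Finset.Icc 1 N).filter (fun h => Nat.gcd h N = 1),
        hurwitzZeta (((h : ℝ) / (N : ℝ) : ℝ) : UnitAddCircle) α *
          hurwitzZeta
            ((-(((((D : ZMod N) * (h : ZMod N))⁻¹).val * (f : ℕ) : ℕ) : ℝ) / (N : ℝ) : ℝ) :
              UnitAddCircle) β =
      2 * Complex.Gamma (1 - α) * Complex.Gamma (1 - β) * (2 * (Real.pi : ℂ)) ^ (α + β - 2) *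
        ∑' p : ℕ+ × ℕ+, ((p.1 : ℕ) : ℂ) ^ (α - 1) *
          (((f : ℕ) : ℂ) ^ (-s) * ((p.2 : ℕ) : ℂ) ^ (β - 1)) *
          kloostermanComb N α β ((p.1 : ℕ) : ZMod N)
            ((D : ZMod N)⁻¹ * ((f * p.2 : ℕ) : ZMod N)) := by
    have h1 := sum_units_hurwitzZeta_mul_hurwitzZeta
      ((D : ZMod N)⁻¹ * ((f : ℕ) : ZMod N)) hα hβ
    have h2 := sum_filter_coprime_eq_sum_units N fun x ↦
      hurwitzZeta (ZMod.toAddCircle x) α *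
        hurwitzZeta (-ZMod.toAddCircle ((((D : ZMod N) * x)⁻¹.val * (f : ℕ) : ℕ) : ZMod N)) β
    simp only [ZMod.toAddCircle_natCast, ← QuotientAddGroup.mk_neg, ← neg_div] at h2
    rw [h2]
    have h3 (x : (ZMod N)ˣ) : ((-((((D : ZMod N) * x)⁻¹.val * (f : ℕ) : ℕ) : ℝ) / (N : ℝ) : ℝ) :
        UnitAddCircle) = -ZMod.toAddCircle ((D : ZMod N)⁻¹ * ((f : ℕ) : ZMod N) *
          ((x⁻¹ : (ZMod N)ˣ) : ZMod N)) := by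
      rw [neg_div, QuotientAddGroup.mk_neg, ← ZMod.toAddCircle_natCast]
      congr 2
      rw [Nat.cast_mul, ZMod.natCast_zmod_val, ← hD', ← Units.val_mul, ZMod.inv_coe_unit,
        ZMod.inv_coe_unit, mul_inv, Units.val_mul]
      ring
    simp only [h3]
    rw [h1, mul_left_comm, ← tsum_mul_left]
    congr 1
    refine tsum_congr fun p ↦ ?_
    push_cast
    rw [mul_assoc (D : ZMod N)⁻¹]
    ring
  obtain ⟨C, hC⟩ := exists_norm_kloostermanComb_le N α β
  have hsum := summable_cpow_mul_bounded hs (a := α - 1) (b := β - 1)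
    (by rw [Complex.sub_re, Complex.one_re]; linarith)
    (by rw [Complex.sub_re, Complex.one_re]; linarith) (C := C)
    (W := fun p ↦ kloostermanComb N α β ((p.1 : ℕ) : ZMod N)
      ((D : ZMod N)⁻¹ * ((p.2.1 * p.2.2 : ℕ) : ZMod N))) (fun p ↦ hC _ _)
  let e : ℕ+ × (ℕ+ × ℕ+) ≃ ℕ+ × (ℕ+ × ℕ+) :=
    { toFun := fun p ↦ (p.2.1, p.1, p.2.2)
      invFun := fun p ↦ (p.2.1, p.1, p.2.2)
      left_inv := fun _ ↦ rfl
      right_inv := fun _ ↦ rfl }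
  have hsum' := e.summable_iff.mpr hsum
  rw [tsum_congr hinner, tsum_mul_left]
  congr 1
  refine hsum'.tsum_prod.symm.trans ((e.tsum_eq _).trans (hsum.tsum_prod.trans ?_))
  refine tsum_congr fun m ↦ ?_
  have hm : ((m : ℕ) : ℂ) ^ (α - 1) ≠ 0 := by simp [Complex.cpow_eq_zero_iff]
  have hfib := (hsum.prod_factor m).mul_left (((m : ℕ) : ℂ) ^ (α - 1))⁻¹
  have hw := tsum_cpow_mul_eq_tsum_sigmaC (s := s) (b := β)
    (w := fun n ↦ kloostermanComb N α β ((m : ℕ) : ZMod N) ((D : ZMod N)⁻¹ * (n : ZMod N)))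
    (hfib.congr fun p ↦ by field_simp)
  simp only [mul_assoc, tsum_mul_left] at hw ⊢
  rw [hw]
  rfl
end

section
/- Let g : ℝ → ℂ be an even Lebesgue-integrable function and let s, w be complex numbers with 0 < Re s < Re w. Then ∫_{0}^{∞} ( ∫_{ℝ} g(t) (1+x)^{i t} dt ) x^{s−1} (1+x)^{−w} dx = Γ(s) ∫_{ℝ} ( Γ(w−s+i t) / Γ(w+i t) ) g(t) dt, both integrals converging absolutely. -/
open Complex MeasureTheory

lemma image_div_one_add_Ioi : (fun x : ℝ => x / (1 + x)) '' Set.Ioi 0 = Set.Ioo 0 1 := by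
  ext y
  constructor
  · rintro ⟨x, hx, rfl⟩
    have hx' : 0 < x := hx
    refine ⟨by positivity, ?_⟩
    rw [div_lt_one (by positivity)]
    linarith
  · rintro ⟨h0, h1⟩
    have h : (0 : ℝ) < 1 - y := by linarith
    refine ⟨y / (1 - y), div_pos h0 h, ?_⟩
    change y / (1 - y) / (1 + y / (1 - y)) = y
    field_simp
    ring

lemma hasDerivAt_div_one_add {x : ℝ} (hx : 0 < x) :
    HasDerivAt (fun x : ℝ => x / (1 + x)) ((1 + x) ^ 2)⁻¹ x := by
  have h := (hasDerivAt_id x).div ((hasDerivAt_id x).const_add 1)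
    (by simp only [id]; positivity)
  refine h.congr_deriv ?_
  simp only [id]
  field_simp
  ring

lemma injOn_div_one_add : Set.InjOn (fun x : ℝ => x / (1 + x)) (Set.Ioi 0) := by
  intro a ha b hb h
  have ha' : 0 < a := ha
  have hb' : 0 < b := hb
  have h' : a / (1 + a) = b / (1 + b) := h
  rw [div_eq_div_iff (by positivity) (by positivity)] at h'
  linarith

lemma beta_integrand_div_one_add (u v : ℂ) {x : ℝ} (hx : 0 < x) :
    |((1 + x) ^ 2)⁻¹| • (((x / (1 + x) : ℝ) : ℂ) ^ (u - 1) *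
      (1 - ((x / (1 + x) : ℝ) : ℂ)) ^ (v - 1))
      = (x : ℂ) ^ (u - 1) * ((1 + x : ℝ) : ℂ) ^ (-(u + v)) := by
  have h1 : (0 : ℝ) < 1 + x := by positivity
  have hc : ((1 + x : ℝ) : ℂ) ≠ 0 := by exact_mod_cast h1.ne'
  have e1 : (1 - ((x / (1 + x) : ℝ) : ℂ)) = (((1 + x)⁻¹ : ℝ) : ℂ) := by
    rw [← ofReal_one, ← ofReal_sub]
    congr 1
    field_simp
    ring
  have inv_cpow (z : ℂ) : (((1 + x)⁻¹ : ℝ) : ℂ) ^ z = ((1 + x : ℝ) : ℂ) ^ (-z) := by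
    rw [ofReal_inv, inv_cpow, cpow_neg]
    rw [arg_ofReal_of_nonneg h1.le]
    exact Real.pi_pos.ne
  have e2 : ((((1 + x) ^ 2)⁻¹ : ℝ) : ℂ) = ((1 + x : ℝ) : ℂ) ^ (-2 : ℂ) := by
    rw [cpow_neg, cpow_ofNat]
    push_cast
    rfl
  rw [e1, abs_of_pos (by positivity), real_smul, div_eq_mul_inv, ofReal_mul,
    mul_cpow_ofReal_nonneg hx.le (by positivity), inv_cpow, inv_cpow, e2]
  have e3 : -(u + v) = -2 + -(u - 1) + -(v - 1) := by ring
  rw [e3, cpow_add _ _ hc, cpow_add _ _ hc]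
  ring

lemma integrableOn_cpow_mul_one_add_cpow {u v : ℂ} (hu : 0 < u.re) (hv : 0 < v.re) :
    IntegrableOn (fun x : ℝ => (x : ℂ) ^ (u - 1) * ((1 + x : ℝ) : ℂ) ^ (-(u + v)))
      (Set.Ioi 0) := by
  have h := betaIntegral_convergent hu hv
  rw [intervalIntegrable_iff_integrableOn_Ioo_of_le zero_le_one, ← image_div_one_add_Ioi,
    integrableOn_image_iff_integrableOn_abs_deriv_smul measurableSet_Ioi
      (fun x hx => (hasDerivAt_div_one_add hx).hasDerivWithinAt) injOn_div_one_add] at h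
  exact h.congr_fun (fun x hx => beta_integrand_div_one_add u v hx) measurableSet_Ioi

lemma integral_cpow_mul_one_add_cpow {u v : ℂ} (hu : 0 < u.re) (hv : 0 < v.re) :
    ∫ x in Set.Ioi (0 : ℝ), (x : ℂ) ^ (u - 1) * ((1 + x : ℝ) : ℂ) ^ (-(u + v))
      = Gamma u * Gamma v / Gamma (u + v) := by
  rw [← betaIntegral_eq_Gamma_mul_div u v hu hv, betaIntegral,
    intervalIntegral.integral_of_le zero_le_one, integral_Ioc_eq_integral_Ioo,
    ← image_div_one_add_Ioi,
    integral_image_eq_integral_abs_deriv_smul measurableSet_Ioi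
      (fun x hx => (hasDerivAt_div_one_add hx).hasDerivWithinAt) injOn_div_one_add]
  exact (setIntegral_congr_fun measurableSet_Ioi
    fun x hx => beta_integrand_div_one_add u v hx).symm

lemma integrable_prod_mul_one_add_cpow {g : ℝ → ℂ} (hg : Integrable g) {s w : ℂ}
    (hs : 0 < s.re) (hsw : s.re < w.re) :
    Integrable (fun p : ℝ × ℝ => ((1 + p.2 : ℝ) : ℂ) ^ (I * (p.1 : ℂ)) *
      (g p.1 * ((p.2 : ℂ) ^ (s - 1) * ((1 + p.2 : ℝ) : ℂ) ^ (-w))))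
      (volume.prod (volume.restrict (Set.Ioi 0))) := by
  have hk := integrableOn_cpow_mul_one_add_cpow hs (v := w - s) (by simpa using hsw)
  rw [add_sub_cancel] at hk
  refine (hg.mul_prod hk).bdd_mul (c := 1) ?_ ?_
  · exact Measurable.aestronglyMeasurable (by fun_prop)
  · have h : ∀ᵐ x ∂(volume.restrict (Set.Ioi (0 : ℝ))), 0 < x :=
      ae_restrict_mem measurableSet_Ioi
    filter_upwards [Measure.quasiMeasurePreserving_snd.ae h] with p hp
    rw [norm_cpow_eq_rpow_re_of_pos (by linarith)]
    simp

/-- The Mellin-transform identity `g*(s,w) = Γ(s) ∫ Γ(w-s+it)/Γ(w+it) g(t) dt` for an even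
integrable weight `g`, with both integrals converging absolutely. -/
theorem mellin_transform_identity (g : ℝ → ℂ) (hg_even : ∀ t, g (-t) = g t)
    (hg : Integrable g) (s w : ℂ) (hs : 0 < s.re) (hsw : s.re < w.re) :
    IntegrableOn
      (fun x : ℝ => (∫ t : ℝ, g t * (((1 + x : ℝ) : ℂ) ^ (Complex.I * (t : ℂ)))) *
        (x : ℂ) ^ (s - 1) * ((1 + x : ℝ) : ℂ) ^ (-w)) (Set.Ioi 0) ∧
    Integrable
      (fun t : ℝ => Complex.Gamma (w - s + Complex.I * t) / Complex.Gamma (w + Complex.I * t)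
        * g t) ∧
    (∫ x in Set.Ioi (0 : ℝ),
        (∫ t : ℝ, g t * (((1 + x : ℝ) : ℂ) ^ (Complex.I * (t : ℂ)))) *
          (x : ℂ) ^ (s - 1) * ((1 + x : ℝ) : ℂ) ^ (-w))
      = Complex.Gamma s *
          ∫ t : ℝ, Complex.Gamma (w - s + Complex.I * t) / Complex.Gamma (w + Complex.I * t)
            * g t := by
  have hF := integrable_prod_mul_one_add_cpow hg hs hsw
  have inner_t (x : ℝ) : ∫ t : ℝ, ((1 + x : ℝ) : ℂ) ^ (I * (t : ℂ)) *
      (g t * ((x : ℂ) ^ (s - 1) * ((1 + x : ℝ) : ℂ) ^ (-w)))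
      = (∫ t : ℝ, g t * (((1 + x : ℝ) : ℂ) ^ (I * (t : ℂ)))) *
        (x : ℂ) ^ (s - 1) * ((1 + x : ℝ) : ℂ) ^ (-w) := by
    rw [mul_assoc, ← integral_mul_const]
    congr 1 with t
    ring
  have inner_x (t : ℝ) : ∫ x in Set.Ioi (0 : ℝ), ((1 + x : ℝ) : ℂ) ^ (I * (t : ℂ)) *
      (g t * ((x : ℂ) ^ (s - 1) * ((1 + x : ℝ) : ℂ) ^ (-w)))
      = Gamma s * (Gamma (w - s + I * (-t : ℝ)) / Gamma (w + I * (-t : ℝ)) * g (-t)) := by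
    have h := integral_cpow_mul_one_add_cpow hs (v := w - s + I * (-t : ℝ)) (by simpa using hsw)
    rw [show s + (w - s + I * (-t : ℝ)) = w + I * (-t : ℝ) by ring] at h
    rw [hg_even, show Gamma s * (Gamma (w - s + I * (-t : ℝ)) / Gamma (w + I * (-t : ℝ)) * g t)
      = g t * (Gamma s * Gamma (w - s + I * (-t : ℝ)) / Gamma (w + I * (-t : ℝ))) by ring,
      ← h, ← integral_const_mul]
    refine setIntegral_congr_fun measurableSet_Ioi fun x hx => ?_
    have hx' : (0 : ℝ) < x := hx
    have hc : ((1 + x : ℝ) : ℂ) ≠ 0 := by exact_mod_cast (by positivity : (0 : ℝ) < 1 + x).ne'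
    have e : -(w + I * (-t : ℝ)) = -w + I * t := by push_cast; ring
    simp only [e, cpow_add _ _ hc]
    ring
  refine ⟨?_, ?_, ?_⟩
  · have h := hF.integral_prod_right
    simp only [inner_t] at h
    exact h
  · have h := hF.integral_prod_left
    simp only [inner_x] at h
    have h' := (h.const_mul (Gamma s)⁻¹).comp_neg
    simpa only [neg_neg, inv_mul_cancel_left₀ (Gamma_ne_zero_of_re_pos hs)] using h'
  · have h := integral_integral_swap (f := fun t x : ℝ => ((1 + x : ℝ) : ℂ) ^ (I * (t : ℂ)) *
      (g t * ((x : ℂ) ^ (s - 1) * ((1 + x : ℝ) : ℂ) ^ (-w)))) hF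
    simp only [inner_t, inner_x] at h
    rw [← h, integral_const_mul]
    congr 1
    exact integral_neg_eq_self
      (fun t : ℝ => Gamma (w - s + I * t) / Gamma (w + I * t) * g t) volume
end

section
/- Let q be a squarefree positive integer and suppose q = v₁·w₁ = v₂·w₂ with v₁, w₁, v₂, w₂ positive. Set D = gcd(v₁, v₂), W = gcd(w₁, w₂), and N = gcd(v₁, w₂)·gcd(w₁, v₂). Then for every complex s with Re s > 1: ∑_{r ≥ 1, gcd(r, N) = 1} φ(D·W·r) · ( W·r·√(v₁ v₂) )^{−2s} = ( ζ(2s−1) / ζ(2s) ) · ∏_{p ∣ D·W} (p − 1)/(p^{2s} − 1) · ∏_{p ∣ N} (p^{s} − p^{1−s})/(p^{2s} − 1), where p runs over primes. -/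
open Complex

lemma Nat.totient_mul_mul_mul_totient {M m n : ℕ} (hM : M ≠ 0) (h : m.Coprime n) :
    Nat.totient (M * (m * n)) * Nat.totient M = Nat.totient (M * m) * Nat.totient (M * n) := by
  have h₁ := Nat.totient_gcd_mul_totient_mul (M * m) (M * n)
  have h₂ := Nat.totient_gcd_mul_totient_mul M (M * (m * n))
  rw [Nat.gcd_eq_left (Nat.dvd_mul_right M _)] at h₂
  rw [Nat.gcd_mul_left, h.gcd_eq_one, mul_one,
    show M * m * (M * n) = M * (M * (m * n)) by ring, h₂] at h₁
  exact mul_right_cancel₀ hM (by linarith)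

lemma Nat.totient_mul_pow_of_dvd {M p : ℕ} (h : p ∣ M) (hp : p.Prime) (e : ℕ) :
    Nat.totient (M * p ^ e) = p ^ e * Nat.totient M := by
  induction e with
  | zero => simp
  | succ e ih =>
    rw [pow_succ', mul_left_comm, Nat.totient_mul_of_prime_of_dvd hp (h.mul_right _), ih]
    ring

/-- The summand `φ(M n) n⁻ᵗ / φ(M)`, restricted to `n` coprime to `N`. -/
noncomputable def totientSummand (M N : ℕ) (t : ℂ) (n : ℕ) : ℂ :=
  if n.Coprime N then (Nat.totient (M * n) : ℂ) / Nat.totient M * (n : ℂ) ^ (-t) else 0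

section totientSummand

variable {M N : ℕ} {t : ℂ}

lemma totientSummand_zero : totientSummand M N t 0 = 0 := by simp [totientSummand]

lemma totientSummand_one (hM : M ≠ 0) : totientSummand M N t 1 = 1 := by
  have : (Nat.totient M : ℂ) ≠ 0 := by simpa using hM
  simp [totientSummand, this]

lemma totientSummand_mul (hM : M ≠ 0) {m n : ℕ} (h : m.Coprime n) :
    totientSummand M N t (m * n) = totientSummand M N t m * totientSummand M N t n := by
  have hφ : (Nat.totient M : ℂ) ≠ 0 := by simpa using hM
  have key : (Nat.totient (M * (m * n)) : ℂ) * Nat.totient M =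
      Nat.totient (M * m) * Nat.totient (M * n) := mod_cast Nat.totient_mul_mul_mul_totient hM h
  by_cases hm : m.Coprime N
  · by_cases hn : n.Coprime N
    · rw [totientSummand, totientSummand, totientSummand, if_pos hm, if_pos hn,
        if_pos (Nat.Coprime.mul_left hm hn), Nat.cast_mul, natCast_mul_natCast_cpow]
      field_simp
      linear_combination key * (m : ℂ) ^ (-t) * (n : ℂ) ^ (-t)
    · simp [totientSummand, Nat.coprime_mul_iff_left, hn]
  · simp [totientSummand, Nat.coprime_mul_iff_left, hm]

lemma summable_norm_totientSummand (ht : 2 < t.re) :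
    Summable (fun n ↦ ‖totientSummand M N t n‖) := by
  have hs : Summable fun n : ℕ ↦ (M / Nat.totient M : ℝ) * (n : ℝ) ^ (1 - t.re) :=
    (Real.summable_nat_rpow.2 (by linarith)).mul_left _
  refine hs.of_nonneg_of_le (fun _ ↦ norm_nonneg _) fun n ↦ ?_
  rcases n.eq_zero_or_pos with rfl | hn
  · simp only [totientSummand_zero, norm_zero]
    positivity
  rw [totientSummand]
  split_ifs
  · have h : (Nat.totient (M * n) : ℝ) ≤ M * n := mod_cast Nat.totient_le _
    have hpow : (n : ℝ) ^ (1 - t.re) = n * (n : ℝ) ^ (-t.re) := by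
      rw [sub_eq_add_neg, Real.rpow_add (by positivity), Real.rpow_one]
    rw [norm_mul, norm_div, norm_natCast, norm_natCast, norm_natCast_cpow_of_pos hn, neg_re, hpow,
      ← mul_assoc, div_mul_eq_mul_div (M : ℝ)]
    exact mul_le_mul_of_nonneg_right (div_le_div_of_nonneg_right h (Nat.cast_nonneg _))
      (by positivity)
  · simp only [norm_zero]
    positivity

lemma natCast_cpow_one_sub {p : ℕ} (hp : p ≠ 0) (t : ℂ) :
    (p : ℂ) ^ (1 - t) = p * (p : ℂ) ^ (-t) := by
  rw [sub_eq_add_neg, cpow_add _ _ (by simpa using hp), cpow_one]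

lemma norm_prime_cpow_lt_one {p : ℕ} (hp : p.Prime) {z : ℂ} (hz : z.re < 0) :
    ‖(p : ℂ) ^ z‖ < 1 := by
  rw [norm_natCast_cpow_of_pos hp.pos]
  exact Real.rpow_lt_one_of_one_lt_of_neg (mod_cast hp.one_lt) hz

lemma one_sub_prime_cpow_ne_zero {p : ℕ} (hp : p.Prime) {z : ℂ} (hz : z.re < 0) :
    1 - (p : ℂ) ^ z ≠ 0 := by
  intro h
  have := norm_prime_cpow_lt_one hp hz
  rw [← sub_eq_zero.1 h] at this
  simp at this

lemma natCast_pow_cpow (p e : ℕ) (z : ℂ) : ((p ^ e : ℕ) : ℂ) ^ z = ((p : ℂ) ^ z) ^ e := by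
  induction e with
  | zero => simp
  | succ e ih => rw [pow_succ, Nat.cast_mul, natCast_mul_natCast_cpow, ih, pow_succ]

lemma tsum_totientSummand_prime_pow_of_dvd_right (hM : M ≠ 0) {p : ℕ} (hp : p.Prime)
    (h : p ∣ N) : ∑' e, totientSummand M N t (p ^ e) = 1 := by
  rw [tsum_eq_single 0, pow_zero, totientSummand_one hM]
  intro e he
  have : ¬ (p ^ e).Coprime N := by
    rw [Nat.coprime_pow_left_iff (Nat.pos_of_ne_zero he), hp.coprime_iff_not_dvd]
    simpa using h
  simp [totientSummand, this]

lemma tsum_totientSummand_prime_pow_of_dvd_left (hM : M ≠ 0) (ht : 2 < t.re) {p : ℕ}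
    (hp : p.Prime) (h : p ∣ M) (hN : ¬ p ∣ N) :
    ∑' e, totientSummand M N t (p ^ e) = (1 - (p : ℂ) ^ (1 - t))⁻¹ := by
  rw [← tsum_geometric_of_norm_lt_one (norm_prime_cpow_lt_one hp (z := 1 - t) (by simp; linarith))]
  refine tsum_congr fun e ↦ ?_
  have hφ : (Nat.totient M : ℂ) ≠ 0 := by simpa using hM
  rw [totientSummand, if_pos (((hp.coprime_iff_not_dvd).2 hN).pow_left e),
    Nat.totient_mul_pow_of_dvd h hp, natCast_pow_cpow, natCast_cpow_one_sub hp.ne_zero, mul_pow]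
  push_cast
  field_simp

lemma tsum_totientSummand_prime_pow_of_not_dvd (hM : M ≠ 0) (ht : 2 < t.re) {p : ℕ}
    (hp : p.Prime) (h : ¬ p ∣ M) (hN : ¬ p ∣ N) :
    ∑' e, totientSummand M N t (p ^ e) =
      (1 - (p : ℂ) ^ (-t)) * (1 - (p : ℂ) ^ (1 - t))⁻¹ := by
  have hφ : (Nat.totient M : ℂ) ≠ 0 := by simpa using hM
  have hlt : ‖(p : ℂ) ^ (1 - t)‖ < 1 := norm_prime_cpow_lt_one hp (by simp; linarith)
  have hne : 1 - (p : ℂ) ^ (1 - t) ≠ 0 := one_sub_prime_cpow_ne_zero hp (by simp; linarith)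
  have hterm (e : ℕ) : totientSummand M N t (p ^ (e + 1)) =
      ((p : ℂ) - 1) * (p : ℂ) ^ (-t) * ((p : ℂ) ^ (1 - t)) ^ e := by
    rw [totientSummand, if_pos (((hp.coprime_iff_not_dvd).2 hN).pow_left _),
      Nat.totient_mul (((hp.coprime_iff_not_dvd).2 h).pow_left _).symm,
      Nat.totient_prime_pow_succ hp, natCast_pow_cpow, natCast_cpow_one_sub hp.ne_zero, mul_pow]
    push_cast [hp.one_le]
    field_simp
    ring
  have hsum : HasSum (fun e ↦ totientSummand M N t (p ^ (e + 1)))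
      (((p : ℂ) - 1) * (p : ℂ) ^ (-t) * (1 - (p : ℂ) ^ (1 - t))⁻¹) := by
    simp_rw [hterm]
    exact (hasSum_geometric_of_norm_lt_one hlt).mul_left _
  rw [((hasSum_nat_add_iff (f := fun e ↦ totientSummand M N t (p ^ e)) 1).1 hsum).tsum_eq,
    Finset.sum_range_one, pow_zero,
    totientSummand_one hM]
  field_simp
  rw [natCast_cpow_one_sub hp.ne_zero]
  ring

end totientSummand

lemma hasProd_primes_ite_dvd {N : ℕ} (hN : N ≠ 0) (f : ℕ → ℂ) :
    HasProd (fun p : Nat.Primes ↦ if (p : ℕ) ∣ N then f p else 1) (∏ p ∈ N.primeFactors, f p) := by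
  have h := hasProd_prod_of_ne_finset_one (L := .unconditional _)
    (f := fun p : Nat.Primes ↦ if (p : ℕ) ∣ N then f p else 1)
    (s := N.primeFactors.subtype Nat.Prime) (by
      intro p hp
      rw [if_neg]
      intro hd
      exact hp (Finset.mem_subtype.2 (Nat.mem_primeFactors.2 ⟨p.2, hd, hN⟩)))
  convert h using 1
  refine (Finset.prod_congr rfl fun p hp ↦ ?_).trans (Finset.prod_subtype_of_mem
    (fun p : ℕ ↦ if p ∣ N then f p else 1) fun p hp ↦ Nat.prime_of_mem_primeFactors hp).symm
  rw [if_pos (Nat.dvd_of_mem_primeFactors hp)]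

lemma tsum_totientSummand {M N : ℕ} {t : ℂ} (hM : M ≠ 0) (hN : N ≠ 0) (hMN : M.Coprime N)
    (ht : 2 < t.re) :
    ∑' n, totientSummand M N t n = riemannZeta (t - 1) / riemannZeta t *
      (∏ p ∈ M.primeFactors, (1 - (p : ℂ) ^ (-t))⁻¹) *
      ∏ p ∈ N.primeFactors, (1 - (p : ℂ) ^ (1 - t)) * (1 - (p : ℂ) ^ (-t))⁻¹ := by
  have hζ : riemannZeta t ≠ 0 := riemannZeta_ne_zero_of_one_lt_re (by linarith)
  have h₁ := (EulerProduct.eulerProduct_hasProd (totientSummand_one (N := N) (t := t) hM)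
    (totientSummand_mul hM) (summable_norm_totientSummand ht) totientSummand_zero).mul
    (riemannZeta_eulerProduct_hasProd (s := t) (by linarith))
  have h₂ := ((riemannZeta_eulerProduct_hasProd (s := t - 1) (by simp; linarith)).mul
    (hasProd_primes_ite_dvd hM fun p ↦ (1 - (p : ℂ) ^ (-t))⁻¹)).mul
    (hasProd_primes_ite_dvd hN fun p ↦ (1 - (p : ℂ) ^ (1 - t)) * (1 - (p : ℂ) ^ (-t))⁻¹)
  have h := h₁.unique <| h₂.congr_fun fun p ↦ ?_
  · rwa [div_mul_eq_mul_div, div_mul_eq_mul_div, eq_div_iff hζ]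
  have hp := p.2
  have hA : 1 - (p : ℂ) ^ (1 - t) ≠ 0 := one_sub_prime_cpow_ne_zero hp (by simp; linarith)
  have hB : 1 - (p : ℂ) ^ (-t) ≠ 0 := one_sub_prime_cpow_ne_zero hp (by simp; linarith)
  rw [neg_sub]
  by_cases hpN : (p : ℕ) ∣ N
  · have hpM : ¬ (p : ℕ) ∣ M := fun hpM ↦ Nat.not_coprime_of_dvd_of_dvd hp.one_lt hpM hpN hMN
    rw [tsum_totientSummand_prime_pow_of_dvd_right hM hp hpN, if_neg hpM, if_pos hpN]
    field_simp
  by_cases hpM : (p : ℕ) ∣ M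
  · rw [tsum_totientSummand_prime_pow_of_dvd_left hM ht hp hpM hpN, if_pos hpM, if_neg hpN,
      mul_one]
  · rw [tsum_totientSummand_prime_pow_of_not_dvd hM ht hp hpM hpN, if_neg hpM, if_neg hpN]
    field_simp

lemma natCast_cpow_eq_prod_primeFactors {n : ℕ} (hn : Squarefree n) (z : ℂ) :
    (n : ℂ) ^ z = ∏ p ∈ n.primeFactors, (p : ℂ) ^ z := by
  have key (S : Finset ℕ) : ((∏ p ∈ S, p : ℕ) : ℂ) ^ z = ∏ p ∈ S, (p : ℂ) ^ z := by
    induction S using Finset.cons_induction with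
    | empty => simp
    | cons a S ha ih =>
      rw [Finset.prod_cons, Finset.prod_cons, Nat.cast_mul, natCast_mul_natCast_cpow, ih]
  rw [← key, Nat.prod_primeFactors_of_squarefree hn]

lemma Nat.totient_eq_prod_primeFactors_sub_one {n : ℕ} (hn : Squarefree n) :
    (Nat.totient n : ℂ) = ∏ p ∈ n.primeFactors, ((p : ℂ) - 1) := by
  have h := Nat.totient_mul_prod_primeFactors n
  rw [Nat.prod_primeFactors_of_squarefree hn, mul_comm] at h
  rw [Nat.eq_of_mul_eq_mul_left hn.ne_zero.bot_lt h, Nat.cast_prod]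
  exact Finset.prod_congr rfl fun p hp ↦ by
    rw [Nat.cast_sub (Nat.prime_of_mem_primeFactors hp).one_le, Nat.cast_one]

lemma ofReal_sqrt_natCast_cpow {N : ℕ} (hN : N ≠ 0) (z : ℂ) :
    ((Real.sqrt N : ℝ) : ℂ) ^ (2 * z) = (N : ℂ) ^ z := by
  have h : ((Real.sqrt N : ℝ) : ℂ) ≠ 0 := by simpa using hN
  rw [two_mul, cpow_add _ _ h, ← mul_cpow_ofReal_nonneg (Real.sqrt_nonneg _) (Real.sqrt_nonneg _),
    ← ofReal_mul, Real.mul_self_sqrt N.cast_nonneg, ofReal_natCast]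

lemma Nat.factor_gcd_of_mul_eq_mul {v₁ w₁ v₂ w₂ : ℕ} (h : v₁ * w₁ = v₂ * w₂)
    (hc : v₂.Coprime w₂) : v₁ = Nat.gcd v₁ v₂ * Nat.gcd v₁ w₂ := by
  rw [← hc.gcd_mul, ← h, Nat.gcd_mul_right_right]

lemma div_cpow_two_mul_sub_one {p : ℕ} (hp : p.Prime) (s a : ℂ) :
    a / ((p : ℂ) ^ (2 * s) - 1) =
      a * ((p : ℂ) ^ (-(2 * s)) * (1 - (p : ℂ) ^ (-(2 * s)))⁻¹) := by
  have h0 : (p : ℂ) ^ (2 * s) ≠ 0 := by simp [cpow_eq_zero_iff, hp.ne_zero]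
  rw [cpow_neg, ← mul_inv, mul_sub, mul_one, mul_inv_cancel₀ h0, div_eq_mul_inv]

lemma tsum_pnat_totient_mul_cpow {M N : ℕ} (h : Squarefree (M * N)) {s : ℂ} (hs : 1 < s.re) :
    (∑' r : ℕ+, if Nat.gcd r N = 1 then
        (Nat.totient (M * r) : ℂ) *
          (((M * r : ℕ) : ℝ) * (Real.sqrt N : ℝ) : ℂ) ^ (-(2 * s)) else 0) =
      riemannZeta (2 * s - 1) / riemannZeta (2 * s) *
        (∏ p ∈ M.primeFactors, ((p : ℂ) - 1) / ((p : ℂ) ^ (2 * s) - 1)) *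
        (∏ p ∈ N.primeFactors,
          ((p : ℂ) ^ s - (p : ℂ) ^ (1 - s)) / ((p : ℂ) ^ (2 * s) - 1)) := by
  obtain ⟨hMN, hM, hN⟩ := Nat.squarefree_mul_iff.1 h
  have ht : 2 < (2 * s).re := by simp; linarith
  have hφ : (Nat.totient M : ℂ) ≠ 0 := by simpa using hM.ne_zero
  have hterm (r : ℕ) : (if Nat.gcd r N = 1 then
        (Nat.totient (M * r) : ℂ) *
          (((M * r : ℕ) : ℝ) * (Real.sqrt N : ℝ) : ℂ) ^ (-(2 * s)) else 0) =
      (Nat.totient M * (M : ℂ) ^ (-(2 * s)) * (N : ℂ) ^ (-s)) *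
        totientSummand M N (2 * s) r := by
    simp only [totientSummand, Nat.coprime_iff_gcd_eq_one]
    split_ifs
    · rw [mul_cpow_ofReal_nonneg (Nat.cast_nonneg _) (Real.sqrt_nonneg _), ← mul_neg,
        ofReal_sqrt_natCast_cpow hN.ne_zero, ofReal_natCast, Nat.cast_mul,
        natCast_mul_natCast_cpow]
      field_simp
    · simp
  have hnat := tsum_zero_pnat_eq_tsum_nat (summable_norm_totientSummand (M := M) (N := N) ht).of_norm
  rw [totientSummand_zero, zero_add] at hnat
  simp_rw [hterm]
  rw [tsum_mul_left, hnat, tsum_totientSummand hM.ne_zero hN.ne_zero hMN ht,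
    Nat.totient_eq_prod_primeFactors_sub_one hM, natCast_cpow_eq_prod_primeFactors hM,
    natCast_cpow_eq_prod_primeFactors hN]
  have hP : ∏ p ∈ M.primeFactors, ((p : ℂ) - 1) / ((p : ℂ) ^ (2 * s) - 1) =
      (∏ p ∈ M.primeFactors, ((p : ℂ) - 1)) * (∏ p ∈ M.primeFactors, (p : ℂ) ^ (-(2 * s))) *
        ∏ p ∈ M.primeFactors, (1 - (p : ℂ) ^ (-(2 * s)))⁻¹ := by
    rw [← Finset.prod_mul_distrib, ← Finset.prod_mul_distrib]
    refine Finset.prod_congr rfl fun p hp ↦ ?_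
    have hp' := Nat.prime_of_mem_primeFactors hp
    rw [div_cpow_two_mul_sub_one hp']
    ring
  have hQ : ∏ p ∈ N.primeFactors, ((p : ℂ) ^ s - (p : ℂ) ^ (1 - s)) / ((p : ℂ) ^ (2 * s) - 1) =
      (∏ p ∈ N.primeFactors, (p : ℂ) ^ (-s)) *
        ∏ p ∈ N.primeFactors,
          (1 - (p : ℂ) ^ (1 - 2 * s)) * (1 - (p : ℂ) ^ (-(2 * s)))⁻¹ := by
    rw [← Finset.prod_mul_distrib]
    refine Finset.prod_congr rfl fun p hp ↦ ?_
    have hp' := Nat.prime_of_mem_primeFactors hp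
    have h0 : (p : ℂ) ≠ 0 := mod_cast hp'.ne_zero
    have e₁ : (p : ℂ) ^ s * (p : ℂ) ^ (-(2 * s)) = (p : ℂ) ^ (-s) := by
      rw [← cpow_add _ _ h0]; ring_nf
    have e₂ : (p : ℂ) ^ (1 - s) * (p : ℂ) ^ (-(2 * s)) = (p : ℂ) ^ (-s) * (p : ℂ) ^ (1 - 2 * s) := by
      rw [← cpow_add _ _ h0, ← cpow_add _ _ h0]; ring_nf
    rw [div_cpow_two_mul_sub_one hp', ← mul_assoc, sub_mul, e₁, e₂]
    ring
  rw [hP, hQ]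
  ring

/-- Evaluation of the totient Dirichlet series attached to two factorizations of a squarefree
level `q = v₁w₁ = v₂w₂`. -/
theorem totient_series_eval (q v₁ w₁ v₂ w₂ : ℕ) (hq : Squarefree q)
    (hv₁ : 0 < v₁) (hw₁ : 0 < w₁) (hv₂ : 0 < v₂) (hw₂ : 0 < w₂)
    (hq₁ : q = v₁ * w₁) (hq₂ : q = v₂ * w₂)
    (s : ℂ) (hs : 1 < s.re) :
    (∑' r : ℕ+,
      if Nat.gcd r (Nat.gcd v₁ w₂ * Nat.gcd w₁ v₂) = 1 then
        (Nat.totient (Nat.gcd v₁ v₂ * Nat.gcd w₁ w₂ * r) : ℂ) *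
          (((Nat.gcd w₁ w₂ * r : ℕ) * Real.sqrt (v₁ * v₂) : ℝ) : ℂ) ^ (-(2 * s))
      else 0)
    = riemannZeta (2 * s - 1) / riemannZeta (2 * s) *
        (∏ p ∈ (Nat.gcd v₁ v₂ * Nat.gcd w₁ w₂).primeFactors,
          ((p : ℂ) - 1) / ((p : ℂ) ^ (2 * s) - 1)) *
        (∏ p ∈ (Nat.gcd v₁ w₂ * Nat.gcd w₁ v₂).primeFactors,
          ((p : ℂ) ^ s - (p : ℂ) ^ (1 - s)) / ((p : ℂ) ^ (2 * s) - 1)) := by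
  have hc₁ : v₁.Coprime w₁ := Nat.coprime_of_squarefree_mul (hq₁ ▸ hq)
  have hc₂ : v₂.Coprime w₂ := Nat.coprime_of_squarefree_mul (hq₂ ▸ hq)
  have hq₁₂ : v₁ * w₁ = v₂ * w₂ := hq₁ ▸ hq₂
  have e₁ : v₁ = v₁.gcd v₂ * v₁.gcd w₂ := Nat.factor_gcd_of_mul_eq_mul hq₁₂ hc₂
  have e₂ : v₂ = v₁.gcd v₂ * w₁.gcd v₂ := by
    rw [Nat.gcd_comm v₁, Nat.gcd_comm w₁]
    exact Nat.factor_gcd_of_mul_eq_mul hq₁₂.symm hc₁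
  have e₃ : w₁ = w₁.gcd v₂ * w₁.gcd w₂ := by
    rw [mul_comm]
    exact Nat.factor_gcd_of_mul_eq_mul (by rw [mul_comm, hq₁₂, mul_comm]) hc₂.symm
  have hsqrt : Real.sqrt (v₁ * v₂) = v₁.gcd v₂ * Real.sqrt (v₁.gcd w₂ * w₁.gcd v₂ : ℕ) := by
    have : (v₁ * v₂ : ℝ) = (v₁.gcd v₂ : ℝ) ^ 2 * (v₁.gcd w₂ * w₁.gcd v₂ : ℕ) := by
      have : v₁ * v₂ = (v₁.gcd v₂) ^ 2 * (v₁.gcd w₂ * w₁.gcd v₂) :=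
        calc v₁ * v₂ = (v₁.gcd v₂ * v₁.gcd w₂) * (v₁.gcd v₂ * w₁.gcd v₂) := by rw [← e₁, ← e₂]
          _ = _ := by ring
      exact_mod_cast this
    rw [this, Real.sqrt_mul (by positivity), Real.sqrt_sq (by positivity)]
  have hMN : (v₁.gcd v₂ * w₁.gcd w₂) * (v₁.gcd w₂ * w₁.gcd v₂) = q :=
    calc _ = (v₁.gcd v₂ * v₁.gcd w₂) * (w₁.gcd v₂ * w₁.gcd w₂) := by ring
      _ = q := by rw [← e₁, ← e₃, hq₁]
  have hterm (r : ℕ) : (((w₁.gcd w₂ * r : ℕ) * Real.sqrt (v₁ * v₂) : ℝ) : ℂ) =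
      ((v₁.gcd v₂ * w₁.gcd w₂ * r : ℕ) : ℝ) *
        (Real.sqrt (v₁.gcd w₂ * w₁.gcd v₂ : ℕ) : ℝ) := by
    rw [hsqrt]
    push_cast
    ring
  simp_rw [hterm]
  generalize v₁.gcd v₂ * w₁.gcd w₂ = M at *
  generalize v₁.gcd w₂ * w₁.gcd v₂ = N at *
  subst hMN
  exact tsum_pnat_totient_mul_cpow hq hs
end

section
/- Let q be a squarefree positive integer and suppose q = v₁·w₁ = v₂·w₂ with v₁, w₁, v₂, w₂ positive. Set D = gcd(v₁, v₂), W = gcd(w₁, w₂), and N = gcd(v₁, w₂)·gcd(w₁, v₂). Then for every positive integer n and every complex s with Re s > 1: ∑_{r ≥ 1, gcd(r, N) = 1} c_{D·W·r}(n) · ( W·r·√(v₁ v₂) )^{−2s} = ( σ_{1−2s}(n; χ_q) / L(2s, χ_q) ) · ( D / lcm(v₁, v₂) )^{s} · ∏_{p ∣ D·W} [ σ_{1−2s}(n_p) (1 − p^{−2s}) − 1 ], where p runs over primes. -/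
open Complex

/-- The Ramanujan sum `c_m(n) = ∑_{h=1, (h,m)=1}^{m} e^{2πi h n/m}`. -/
noncomputable def ramanujanSum (m n : ℕ) : ℂ :=
  ∑ h ∈ (Finset.Icc 1 m).filter (fun h => Nat.gcd h m = 1),
    Complex.exp (2 * Real.pi * Complex.I * h * n / m)

/-- The divisor function twisted by the principal character mod `q`:
`σ_α(n; χ_q) = ∑_{d ∣ n, (d,q)=1} d^α`. -/
noncomputable def sigmaTwisted (α : ℂ) (n q : ℕ) : ℂ :=
  ∑ d ∈ n.divisors.filter (fun d => Nat.gcd d q = 1), (d : ℂ) ^ α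

/-- The Dirichlet L-function of the principal character mod `q`:
`L(s, χ_q) = ζ(s) ∏_{p ∣ q} (1 - p^{-s})`. -/
noncomputable def LPrincipal (q : ℕ) (s : ℂ) : ℂ :=
  riemannZeta s * ∏ p ∈ q.primeFactors, (1 - (p : ℂ) ^ (-s))

open Finset in
/-- Sum of the `n`-th powers of all `k`-th roots of unity. -/
theorem sum_Icc_exp_eq_ite (k n : ℕ) (hk : 0 < k) :
    ∑ h ∈ Icc 1 k, Complex.exp (2 * Real.pi * Complex.I * h * n / k) =
      if k ∣ n then (k : ℂ) else 0 := by
  have hk' : (k : ℂ) ≠ 0 := by exact_mod_cast hk.ne'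
  set x : ℂ := Complex.exp (2 * Real.pi * Complex.I / k) ^ n with hx
  have hprim := Complex.isPrimitiveRoot_exp k hk.ne'
  have hterm (h : ℕ) : Complex.exp (2 * Real.pi * Complex.I * h * n / k) = x ^ h := by
    rw [hx, ← pow_mul, ← Complex.exp_nat_mul]
    congr 1
    push_cast
    ring
  have hx1 : x = 1 ↔ k ∣ n := hprim.pow_eq_one_iff_dvd n
  simp_rw [hterm]
  split_ifs with hdvd
  · simp [hx1.2 hdvd]
  · have hne : x ≠ 1 := fun h => hdvd (hx1.1 h)
    have hxk : x ^ k = 1 := by rw [hx, ← pow_mul, mul_comm n k, pow_mul, hprim.pow_eq_one, one_pow]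
    have hIcc : Icc 1 k = Ico 1 (k + 1) := by ext; simp
    rw [hIcc, geom_sum_Ico hne (by omega), pow_succ, hxk]
    simp

open Finset ArithmeticFunction in
/-- Ramanujan sums as a Dirichlet convolution: `c_m(n) = ∑_{d ∣ gcd(m,n)} d μ(m/d)`. -/
theorem ramanujanSum_eq_convolution (n : ℕ) :
    (fun m => ramanujanSum m n) =
      LSeries.convolution (fun d => if d ∣ n then (d : ℂ) else 0) (fun m => (moebius m : ℂ)) := by
  ext m
  rcases Nat.eq_zero_or_pos m with rfl | hm
  · simp [ramanujanSum]
  simp only [LSeries.convolution_def]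
  have hmoeb (h : ℕ) (hh : h ∈ Icc 1 m) : (if Nat.gcd h m = 1 then
      Complex.exp (2 * Real.pi * Complex.I * h * n / m) else 0) =
      ∑ e ∈ m.divisors, if e ∣ h then
        (moebius e : ℂ) * Complex.exp (2 * Real.pi * Complex.I * h * n / m) else 0 := by
    rw [← sum_filter, ← sum_mul]
    have hdiv : m.divisors.filter (· ∣ h) = (Nat.gcd h m).divisors := by
      ext e
      simp [Nat.dvd_gcd_iff, hm.ne', and_comm]
    have hsum : ∑ e ∈ (Nat.gcd h m).divisors, (moebius e : ℂ) =
        if Nat.gcd h m = 1 then 1 else 0 := by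
      have := congrArg (fun f : ArithmeticFunction ℤ => ((f (Nat.gcd h m) : ℤ) : ℂ))
        coe_zeta_mul_moebius
      simp only [coe_zeta_mul_apply, one_apply] at this
      exact_mod_cast this
    rw [hdiv, hsum]
    simp
  rw [ramanujanSum, sum_filter, sum_congr rfl hmoeb, sum_comm,
    Nat.sum_divisorsAntidiagonal' (f := fun a b => (if a ∣ n then (a : ℂ) else 0) * (moebius b : ℂ))]
  refine sum_congr rfl fun e he => ?_
  obtain ⟨k, rfl⟩ := Nat.dvd_of_mem_divisors he
  have he0 : 0 < e := Nat.pos_of_mul_pos_right hm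
  have hk0 : 0 < k := Nat.pos_of_mul_pos_left hm
  rw [Nat.mul_div_cancel_left _ he0, ← sum_Icc_exp_eq_ite k n hk0, ← sum_filter, sum_mul]
  symm
  refine sum_nbij (e * ·) ?_ ?_ ?_ ?_
  · intro h hh
    simp only [mem_Icc, mem_filter] at hh ⊢
    exact ⟨⟨Nat.mul_pos he0 hh.1, Nat.mul_le_mul_left _ hh.2⟩, dvd_mul_right _ _⟩
  · intro a _ b _ hab
    exact Nat.eq_of_mul_eq_mul_left he0 hab
  · intro h hh
    simp only [coe_filter, mem_Icc, Set.mem_ofPred_eq] at hh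
    obtain ⟨⟨h1, h2⟩, j, rfl⟩ := hh
    refine ⟨j, ?_, rfl⟩
    simp only [coe_Icc, Set.mem_Icc]
    exact ⟨Nat.pos_of_mul_pos_left h1, Nat.le_of_mul_le_mul_left h2 he0⟩
  · intro h _
    have he' : (e : ℂ) ≠ 0 := by exact_mod_cast he0.ne'
    have hk' : (k : ℂ) ≠ 0 := by exact_mod_cast hk0.ne'
    rw [mul_comm]
    congr 2
    push_cast
    field_simp

theorem lseriesHasSum_divisor_indicator (χ : ℕ → ℂ) (n : ℕ) (hn : 0 < n) (z : ℂ) :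
    LSeriesHasSum (χ * fun d => if d ∣ n then (d : ℂ) else 0) z
      (∑ d ∈ n.divisors, χ d * (d : ℂ) ^ (1 - z)) := by
  have hsum : ∑ d ∈ n.divisors, χ d * (d : ℂ) ^ (1 - z) =
      ∑ d ∈ n.divisors, LSeries.term (χ * fun d => if d ∣ n then (d : ℂ) else 0) z d := by
    refine Finset.sum_congr rfl fun d hd => ?_
    have hd0 : d ≠ 0 := (Nat.pos_of_mem_divisors hd).ne'
    rw [LSeries.term_of_ne_zero hd0, Complex.cpow_sub _ _ (by exact_mod_cast hd0)]
    simp [Nat.dvd_of_mem_divisors hd, mul_div_assoc]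
  rw [hsum]
  refine hasSum_sum_of_ne_finset_zero fun d hd => ?_
  have : ¬ d ∣ n := fun h => hd (Nat.mem_divisors.2 ⟨h, hn.ne'⟩)
  simp [LSeries.term_def, this]

theorem lseriesSummable_ramanujanSum (n : ℕ) (hn : 0 < n) (z : ℂ) (hz : 1 < z.re) :
    LSeriesSummable (fun m => ramanujanSum m n) z := by
  rw [ramanujanSum_eq_convolution]
  refine LSeriesSummable.convolution ?_
    (ArithmeticFunction.LSeriesSummable_moebius_iff.2 hz)
  simpa using (lseriesHasSum_divisor_indicator 1 n hn z).LSeriesSummable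

theorem trivChar_natCast_eq_ite (Q m : ℕ) :
    (1 : DirichletCharacter ℂ Q) (m : ZMod Q) = if Nat.gcd m Q = 1 then 1 else 0 := by
  split_ifs with h
  · exact MulChar.one_apply ((ZMod.isUnit_iff_coprime m Q).2 h)
  · exact MulChar.map_nonunit _ fun hu => h ((ZMod.isUnit_iff_coprime m Q).1 hu)

theorem tsum_term_ramanujanSum_coprime (n : ℕ) (hn : 0 < n) (z : ℂ) (hz : 1 < z.re)
    (Q : ℕ) (hQ : Q ≠ 0) :
    (∑' m : ℕ, if Nat.gcd m Q = 1 then LSeries.term (fun m => ramanujanSum m n) z m else 0) =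
      sigmaTwisted (1 - z) n Q / LPrincipal Q z := by
  have : NeZero Q := ⟨hQ⟩
  set χ : DirichletCharacter ℂ Q := 1 with hχ
  have hL : LSeries (fun m => χ m) z = LPrincipal Q z := by
    have hz1 : z ≠ 1 := by rintro rfl; simp at hz
    rw [← DirichletCharacter.LFunction_eq_LSeries χ hz, LPrincipal, mul_comm]
    exact DirichletCharacter.LFunctionTrivChar_eq_mul_riemannZeta hz1
  have hinv := DirichletCharacter.LSeries.mul_mu_eq_one χ hz
  rw [hL] at hinv
  have hg := lseriesHasSum_divisor_indicator (fun m => χ m) n hn z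
  have hμ := DirichletCharacter.LSeriesSummable_mul χ
    (ArithmeticFunction.LSeriesSummable_moebius_iff.2 hz)
  have hconv := (hg.convolution hμ.LSeriesHasSum).LSeries_eq
  rw [χ.mul_convolution_distrib, ← ramanujanSum_eq_convolution] at hconv
  have hσ : ∑ d ∈ n.divisors, χ d * (d : ℂ) ^ (1 - z) = sigmaTwisted (1 - z) n Q := by
    rw [sigmaTwisted, Finset.sum_filter]
    refine Finset.sum_congr rfl fun d _ => ?_
    rw [hχ, trivChar_natCast_eq_ite]
    split_ifs <;> simp
  rw [hσ] at hconv
  rw [eq_div_of_mul_eq (left_ne_zero_of_mul_eq_one hinv) ((mul_comm _ _).trans hinv),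
    mul_one_div] at hconv
  rw [← hconv, LSeries]
  refine tsum_congr fun m => ?_
  simp only [LSeries.term_def, Pi.mul_apply, hχ, trivChar_natCast_eq_ite]
  split_ifs <;> simp

/-- Splitting off the `p`-part of the twisted divisor function. -/
theorem sigmaTwisted_eq_mul_sigmaC (α : ℂ) (n Q p : ℕ) (hn : 0 < n) (hp : p.Prime)
    (hpQ : ¬ p ∣ Q) :
    sigmaTwisted α n Q = sigmaTwisted α n (Q * p) * sigmaC α (p ^ n.factorization p) := by
  have hcop {x d : ℕ} (hx : x ∣ p ^ n.factorization p) (hd : Nat.gcd d (Q * p) = 1) :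
      Nat.Coprime x d := by
    have hdp : Nat.Coprime p d := (Nat.Coprime.coprime_mul_left_right (k := Q) hd).symm
    exact Nat.Coprime.coprime_dvd_left hx (hdp.pow_left _)
  rw [sigmaTwisted, sigmaTwisted, sigmaC, Finset.sum_mul_sum, ← Finset.sum_product']
  symm
  refine Finset.sum_nbij (fun y => y.1 * y.2) ?_ ?_ ?_ ?_
  · rintro ⟨d, x⟩ h
    simp only [Finset.mem_product, Finset.mem_filter, Nat.mem_divisors] at h ⊢
    obtain ⟨⟨⟨hdn, -⟩, hdQ⟩, hx, -⟩ := h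
    refine ⟨⟨(hcop hx hdQ).symm.mul_dvd_of_dvd_of_dvd hdn (hx.trans (Nat.ordProj_dvd n p)),
      hn.ne'⟩, ?_⟩
    have hpQ' : Nat.Coprime (p ^ n.factorization p) Q :=
      ((Nat.Prime.coprime_iff_not_dvd hp).2 hpQ).pow_left _
    exact Nat.Coprime.mul_left (Nat.Coprime.coprime_mul_right_right hdQ)
      (Nat.Coprime.coprime_dvd_left hx hpQ')
  · rintro ⟨d, x⟩ h ⟨d', x'⟩ h' heq
    simp only [Finset.coe_product, Set.mem_prod, Finset.mem_coe, Finset.mem_filter,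
      Nat.mem_divisors] at h h' heq
    obtain ⟨⟨⟨hdn, -⟩, hdQ⟩, hx, -⟩ := h
    obtain ⟨⟨⟨hdn', -⟩, hdQ'⟩, hx', -⟩ := h'
    have e1 : x = x' := Nat.dvd_antisymm
      ((hcop hx hdQ').dvd_of_dvd_mul_left (heq ▸ dvd_mul_left x d))
      ((hcop hx' hdQ).dvd_of_dvd_mul_left (heq ▸ dvd_mul_left x' d'))
    subst e1
    have hx0 : 0 < x := Nat.pos_of_dvd_of_pos hx (pow_pos hp.pos _)
    rw [Nat.eq_of_mul_eq_mul_right hx0 heq]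
  · intro e he
    simp only [Finset.coe_filter, Nat.mem_divisors, Set.mem_ofPred_eq] at he
    obtain ⟨⟨hen, -⟩, heQ⟩ := he
    have he0 : e ≠ 0 := (Nat.pos_of_dvd_of_pos hen hn).ne'
    refine ⟨(e / p ^ e.factorization p, p ^ e.factorization p), ?_, ?_⟩
    · simp only [Finset.coe_product, Set.mem_prod, Finset.mem_coe, Finset.mem_filter,
        Nat.mem_divisors]
      have hdiv : e / p ^ e.factorization p ∣ e := Nat.ordCompl_dvd e p
      refine ⟨⟨⟨hdiv.trans hen, hn.ne'⟩, ?_⟩, ?_, (pow_pos hp.pos _).ne'⟩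
      · exact Nat.Coprime.mul_right (Nat.Coprime.coprime_dvd_left hdiv heQ)
          (Nat.coprime_ordCompl hp he0).symm
      · exact pow_dvd_pow _ ((Nat.factorization_le_iff_dvd he0 hn.ne').2 hen p)
    · simp only
      rw [mul_comm]
      exact Nat.ordProj_mul_ordCompl_eq_self e p
  · rintro ⟨d, x⟩ _
    simp only
    push_cast
    rw [Complex.natCast_mul_natCast_cpow]

theorem LPrincipal_mul_prime (Q p : ℕ) (hp : p.Prime) (hpQ : ¬ p ∣ Q) (z : ℂ) :
    LPrincipal (Q * p) z = LPrincipal Q z * (1 - (p : ℂ) ^ (-z)) := by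
  have hcop : Nat.Coprime Q p := ((Nat.Prime.coprime_iff_not_dvd hp).2 hpQ).symm
  rw [LPrincipal, LPrincipal, hcop.primeFactors_mul, hp.primeFactors,
    Finset.prod_union (by simp [hpQ]), Finset.prod_singleton, mul_assoc]

theorem one_sub_natCast_cpow_neg_ne_zero (p : ℕ) (hp : p.Prime) (z : ℂ) (hz : 1 < z.re) :
    1 - (p : ℂ) ^ (-z) ≠ 0 := by
  intro h
  have h1 : ‖(p : ℂ) ^ (-z)‖ = 1 := by rw [← sub_eq_zero.1 h, norm_one]
  rw [Complex.norm_natCast_cpow_of_pos hp.pos] at h1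
  have : (p : ℝ) ^ (-z).re < 1 := Real.rpow_lt_one_of_one_lt_of_neg
    (by exact_mod_cast hp.one_lt) (by simp; linarith)
  linarith

/-- The Dirichlet series of Ramanujan sums over `m` coprime to `N` and divisible by all primes
of `T`. -/
theorem tsum_term_ramanujanSum_dvd_coprime (n : ℕ) (hn : 0 < n) (z : ℂ) (hz : 1 < z.re)
    (T : Finset ℕ) : ∀ N : ℕ, N ≠ 0 → (∀ p ∈ T, p.Prime ∧ ¬ p ∣ N) →
    (∑' m : ℕ, if (∀ p ∈ T, p ∣ m) ∧ Nat.gcd m N = 1 then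
        LSeries.term (fun m => ramanujanSum m n) z m else 0) =
      sigmaTwisted (1 - z) n (N * ∏ p ∈ T, p) / LPrincipal (N * ∏ p ∈ T, p) z *
        ∏ p ∈ T, (sigmaC (1 - z) (p ^ n.factorization p) * (1 - (p : ℂ) ^ (-z)) - 1) := by
  have hsummable (P : ℕ → Prop) [DecidablePred P] : Summable fun m =>
      if P m then LSeries.term (fun m => ramanujanSum m n) z m else 0 := by
    refine Summable.of_norm_bounded (lseriesSummable_ramanujanSum n hn z hz).norm fun m => ?_
    split_ifs <;> simp
  induction T using Finset.induction_on with
  | empty =>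
    intro N hN _
    simpa using tsum_term_ramanujanSum_coprime n hn z hz N hN
  | insert p T hpT ih =>
    intro N hN hT
    obtain ⟨hp, hpN⟩ := hT p (Finset.mem_insert_self _ _)
    have hT' (r : ℕ) (hr : r ∈ T) := hT r (Finset.mem_insert_of_mem hr)
    have hsplit : (∑' m : ℕ, if (∀ r ∈ insert p T, r ∣ m) ∧ Nat.gcd m N = 1 then
          LSeries.term (fun m => ramanujanSum m n) z m else 0) =
        (∑' m : ℕ, if (∀ r ∈ T, r ∣ m) ∧ Nat.gcd m N = 1 then
          LSeries.term (fun m => ramanujanSum m n) z m else 0) -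
        ∑' m : ℕ, if (∀ r ∈ T, r ∣ m) ∧ Nat.gcd m (N * p) = 1 then
          LSeries.term (fun m => ramanujanSum m n) z m else 0 := by
      rw [← (hsummable _).tsum_sub (hsummable _)]
      refine tsum_congr fun m => ?_
      have hgcd : Nat.gcd m (N * p) = 1 ↔ Nat.gcd m N = 1 ∧ ¬ p ∣ m := by
        have := Nat.coprime_mul_iff_right (k := m) (m := N) (n := p)
        rw [Nat.coprime_comm (n := m) (m := p), Nat.Prime.coprime_iff_not_dvd hp] at this
        exact this
      simp only [Finset.forall_mem_insert, hgcd]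
      by_cases h1 : p ∣ m <;> by_cases h2 : ∀ r ∈ T, r ∣ m <;>
        by_cases h3 : Nat.gcd m N = 1 <;> simp [h1, h2, h3]
    rw [hsplit, ih N hN fun r hr => ⟨(hT' r hr).1, (hT' r hr).2⟩,
      ih (N * p) (Nat.mul_ne_zero hN hp.ne_zero) fun r hr => ⟨(hT' r hr).1, fun h => ?_⟩]
    · have hpQ : ¬ p ∣ N * ∏ r ∈ T, r := by
        rw [hp.dvd_mul, hp.prime.dvd_finsetProd_iff]
        rintro (h | ⟨r, hr, h⟩)
        · exact hpN h
        · exact hpT (((Nat.prime_dvd_prime_iff_eq hp (hT' r hr).1).1 h) ▸ hr)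
      rw [Finset.prod_insert hpT, Finset.prod_insert hpT, mul_right_comm N p,
        mul_comm p (∏ r ∈ T, r), ← mul_assoc N, sigmaTwisted_eq_mul_sigmaC (1 - z) n _ p hn hp hpQ,
        LPrincipal_mul_prime _ p hp hpQ]
      have hE := one_sub_natCast_cpow_neg_ne_zero p hp z hz
      generalize 1 - (p : ℂ) ^ (-z) = E at hE ⊢
      generalize sigmaC (1 - z) (p ^ n.factorization p) = b
      generalize sigmaTwisted (1 - z) n ((N * ∏ r ∈ T, r) * p) = a
      generalize LPrincipal (N * ∏ r ∈ T, r) z = L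
      generalize ∏ p ∈ T, (sigmaC (1 - z) (p ^ n.factorization p) * (1 - (p : ℂ) ^ (-z)) - 1) = P
      simp only [div_eq_mul_inv, mul_inv]
      linear_combination (-(a * b * L⁻¹ * P)) * mul_inv_cancel₀ hE
    · rcases (hT' r hr).1.dvd_mul.1 h with h | h
      · exact (hT' r hr).2 h
      · exact hpT (((Nat.prime_dvd_prime_iff_eq (hT' r hr).1 hp).1 h) ▸ hr)

/-- Reindexing of the multiples of `M` that are coprime to `N`. -/
theorem tsum_pnat_mul_eq_tsum_dvd (f : ℕ → ℂ) (hf : f 0 = 0) (M N : ℕ) (hM : Squarefree M)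
    (hMN : Nat.Coprime M N) :
    (∑' r : ℕ+, if Nat.gcd r N = 1 then f (M * r) else 0) =
      ∑' m : ℕ, if (∀ p ∈ M.primeFactors, p ∣ m) ∧ Nat.gcd m N = 1 then f m else 0 := by
  have hM0 : 0 < M := Nat.pos_of_ne_zero hM.ne_zero
  have hdvd (m : ℕ) : (∀ p ∈ M.primeFactors, p ∣ m) ↔ M ∣ m := by
    refine ⟨fun h => ?_, fun h p hp => (Nat.dvd_of_mem_primeFactors hp).trans h⟩
    rw [← Nat.prod_primeFactors_of_squarefree hM]
    exact Finset.prod_primes_dvd m (fun p hp => (Nat.prime_of_mem_primeFactors hp).prime) h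
  have hinj : Function.Injective fun r : ℕ+ => M * (r : ℕ) := fun a b h =>
    PNat.eq (Nat.eq_of_mul_eq_mul_left hM0 h)
  simp_rw [hdvd]
  rw [← hinj.tsum_eq]
  · refine tsum_congr fun r => ?_
    have hgcd : Nat.gcd (M * r) N = 1 ↔ Nat.gcd r N = 1 := by
      rw [hMN.gcd_mul_left_cancel]
    simp [hgcd]
  · intro m hm
    rw [Function.mem_support, ne_eq, ite_eq_right_iff] at hm
    push Not at hm
    obtain ⟨⟨⟨r, rfl⟩, -⟩, hr⟩ := hm
    have hr0 : 0 < r := Nat.pos_of_ne_zero (by rintro rfl; exact hr (by simpa using hf))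
    exact ⟨⟨r, hr0⟩, rfl⟩

theorem mul_sqrt_cpow_neg_two_mul (x y : ℝ) (hx : 0 ≤ x) (hy : 0 < y) (s : ℂ) :
    ((x * Real.sqrt y : ℝ) : ℂ) ^ (-(2 * s)) = (x : ℂ) ^ (-(2 * s)) * (y : ℂ) ^ (-s) := by
  have hne : (Real.sqrt y : ℂ) ≠ 0 := by exact_mod_cast (Real.sqrt_pos.2 hy).ne'
  have hsq : (y : ℂ) ^ (-s) = (Real.sqrt y : ℂ) ^ (-(2 * s)) := by
    conv_lhs => rw [← Real.mul_self_sqrt hy.le]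
    rw [Complex.ofReal_mul, Complex.mul_cpow_ofReal_nonneg (Real.sqrt_nonneg y)
      (Real.sqrt_nonneg y), ← Complex.cpow_add _ _ hne]
    congr 1
    ring
  rw [hsq, Complex.ofReal_mul, Complex.mul_cpow_ofReal_nonneg hx (Real.sqrt_nonneg y)]

/-- Evaluation of the Ramanujan-sum Dirichlet series attached to two factorizations of a
squarefree level `q = v₁w₁ = v₂w₂`. -/
theorem ramanujan_series_eval (q v₁ w₁ v₂ w₂ : ℕ) (hq : Squarefree q)
    (hv₁ : 0 < v₁) (hw₁ : 0 < w₁) (hv₂ : 0 < v₂) (hw₂ : 0 < w₂)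
    (hq₁ : q = v₁ * w₁) (hq₂ : q = v₂ * w₂)
    (n : ℕ) (hn : 0 < n) (s : ℂ) (hs : 1 < s.re) :
    (∑' r : ℕ+,
      if Nat.gcd r (Nat.gcd v₁ w₂ * Nat.gcd w₁ v₂) = 1 then
        ramanujanSum (Nat.gcd v₁ v₂ * Nat.gcd w₁ w₂ * r) n *
          (((Nat.gcd w₁ w₂ * r : ℕ) * Real.sqrt (v₁ * v₂) : ℝ) : ℂ) ^ (-(2 * s))
      else 0)
    = sigmaTwisted (1 - 2 * s) n q / LPrincipal q (2 * s) *
        ((Nat.gcd v₁ v₂ : ℂ) / (Nat.lcm v₁ v₂ : ℂ)) ^ s *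
        ∏ p ∈ (Nat.gcd v₁ v₂ * Nat.gcd w₁ w₂).primeFactors,
          (sigmaC (1 - 2 * s) (p ^ n.factorization p) * (1 - (p : ℂ) ^ (-(2 * s))) - 1) := by
  have hcop₁ : Nat.Coprime v₁ w₁ := Nat.coprime_of_squarefree_mul (hq₁ ▸ hq)
  have hcop₂ : Nat.Coprime v₂ w₂ := Nat.coprime_of_squarefree_mul (hq₂ ▸ hq)
  have ev₁ : v₁ = Nat.gcd v₁ v₂ * Nat.gcd v₁ w₂ := by
    rw [← hcop₂.gcd_mul, ← hq₂, hq₁, Nat.gcd_mul_right_right]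
  have ew₁ : w₁ = Nat.gcd w₁ v₂ * Nat.gcd w₁ w₂ := by
    rw [← hcop₂.gcd_mul, ← hq₂, hq₁, Nat.gcd_mul_left_right]
  have ev₂ : v₂ = Nat.gcd v₁ v₂ * Nat.gcd w₁ v₂ := by
    rw [Nat.gcd_comm v₁, Nat.gcd_comm w₁, ← hcop₁.gcd_mul, ← hq₁, hq₂, Nat.gcd_mul_right_right]
  have hlcm := Nat.gcd_mul_lcm v₁ v₂
  have hD0 : 0 < Nat.gcd v₁ v₂ := Nat.gcd_pos_of_pos_left _ hv₁
  have hW0 : 0 < Nat.gcd w₁ w₂ := Nat.gcd_pos_of_pos_left _ hw₁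
  have ha0 : 0 < Nat.gcd v₁ w₂ := Nat.gcd_pos_of_pos_left _ hv₁
  have hb0 : 0 < Nat.gcd w₁ v₂ := Nat.gcd_pos_of_pos_left _ hw₁
  generalize Nat.gcd v₁ v₂ = D at *
  generalize Nat.gcd w₁ w₂ = W at *
  generalize Nat.gcd v₁ w₂ = a at *
  generalize Nat.gcd w₁ v₂ = b at *
  generalize Nat.lcm v₁ v₂ = l at *
  subst ev₁ ew₁ ev₂
  have hl : l = D * (a * b) := Nat.eq_of_mul_eq_mul_left hD0 (hlcm.trans (by ring))
  have hqMN : q = a * b * (D * W) := hq₁.trans (by ring)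
  have hM : Squarefree (D * W) := hq.squarefree_of_dvd (hqMN ▸ dvd_mul_left _ _)
  have hNM : Nat.Coprime (a * b) (D * W) := Nat.coprime_of_squarefree_mul (hqMN ▸ hq)
  have hN0 : 0 < a * b := Nat.mul_pos ha0 hb0
  have hsqrt : Real.sqrt ((D * a : ℕ) * (D * b : ℕ)) = D * Real.sqrt (a * b : ℕ) := by
    rw [← Real.sqrt_sq (Nat.cast_nonneg D : (0 : ℝ) ≤ D), ← Real.sqrt_mul (by positivity)]
    congr 1
    push_cast
    ring
  rw [hsqrt]
  generalize a * b = N at *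
  have hN : (0 : ℝ) < (N : ℕ) := by exact_mod_cast hN0
  have hz : 1 < (2 * s).re := by simp; linarith
  have hseries := tsum_term_ramanujanSum_dvd_coprime n hn (2 * s) hz (D * W).primeFactors N hN0.ne'
    fun p hp => ⟨Nat.prime_of_mem_primeFactors hp, fun h =>
      Nat.not_coprime_of_dvd_of_dvd (Nat.prime_of_mem_primeFactors hp).one_lt h
        (Nat.dvd_of_mem_primeFactors hp) hNM⟩
  rw [Nat.prod_primeFactors_of_squarefree hM, ← hqMN, ← tsum_pnat_mul_eq_tsum_dvd _
    (LSeries.term_zero _ _) _ _ hM hNM.symm] at hseries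
  have hfactor : ((D : ℂ) / (l : ℂ)) ^ s = (N : ℂ) ^ (-s) := by
    have hD : (D : ℂ) ≠ 0 := by exact_mod_cast hD0.ne'
    rw [hl, Nat.cast_mul, div_mul_cancel_left₀ hD, Complex.inv_cpow _ _
      (by simp [Complex.natCast_arg, Real.pi_ne_zero.symm]), Complex.cpow_neg]
  rw [hfactor, mul_right_comm, ← hseries, ← tsum_mul_right]
  refine tsum_congr fun r => ?_
  rw [ite_mul, zero_mul]
  refine if_congr Iff.rfl ?_ rfl
  have hm0 : D * W * (r : ℕ) ≠ 0 := (Nat.mul_pos (Nat.mul_pos hD0 hW0) r.pos).ne'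
  have hassoc : (((W * r : ℕ) : ℝ) * (D * Real.sqrt (N : ℕ)) : ℝ) =
      ((D * W * r : ℕ) : ℝ) * Real.sqrt (N : ℕ) := by
    push_cast
    ring
  rw [LSeries.term_of_ne_zero hm0, hassoc, mul_sqrt_cpow_neg_two_mul _ _ (Nat.cast_nonneg _) hN,
    Complex.ofReal_natCast, Complex.ofReal_natCast, Complex.cpow_neg _ (2 * s), div_eq_mul_inv]
  exact (mul_assoc _ _ _).symm
end

section
/- Let q be a squarefree positive integer, l a positive divisor of q, and let α, β, s be complex numbers with Re s > 1 + max(0, Re α, Re β, Re(α+β)). Then ∑_{n ≥ 1, gcd(n, l) = 1} σ_β(n; χ_q) · σ_α(n) · n^{−s} = [ L(s, χ_q) L(s−β, χ_q) L(s−α, χ_q) L(s−β−α, χ_q) / L(2s−β−α, χ_q) ] · ∏_{p ∣ q/l} (1 − p^{−s})^{−1} (1 − p^{−(s−α)})^{−1}, where p runs over primes. -/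
open Complex

open scoped ArithmeticFunction.zeta

lemma sigmaTwisted_one (α : ℂ) (n : ℕ) : sigmaTwisted α n 1 = sigmaC α n := by
  simp [sigmaTwisted, sigmaC]

/-- The summand `d ↦ 1_{(d,q)=1} d^α` of the twisted divisor function. -/
noncomputable def coprimeCpow (α : ℂ) (q : ℕ) : ArithmeticFunction ℂ :=
  ⟨fun d => if d ≠ 0 ∧ Nat.gcd d q = 1 then (d : ℂ) ^ α else 0, by simp⟩

lemma coprimeCpow_isMultiplicative (α : ℂ) (q : ℕ) : (coprimeCpow α q).IsMultiplicative := by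
  refine ⟨by simp [coprimeCpow], fun {m n} _ => ?_⟩
  have h : (m * n).gcd q = 1 ↔ m.gcd q = 1 ∧ n.gcd q = 1 := Nat.coprime_mul_iff_left
  simp only [coprimeCpow, ArithmeticFunction.coe_mk, h, Nat.cast_mul,
    Complex.natCast_mul_natCast_cpow, mul_ne_zero_iff, ne_eq]
  split_ifs <;> simp_all

lemma sigmaTwisted_eq_mul_zeta (α : ℂ) (q n : ℕ) :
    sigmaTwisted α n q = (coprimeCpow α q * ζ) n := by
  rw [ArithmeticFunction.coe_mul_zeta_apply, sigmaTwisted, Finset.sum_filter]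
  refine Finset.sum_congr rfl fun d hd => ?_
  simp [coprimeCpow, (Nat.pos_of_mem_divisors hd).ne']

lemma sigmaTwisted_mul (α : ℂ) (q : ℕ) {m n : ℕ} (h : m.Coprime n) :
    sigmaTwisted α (m * n) q = sigmaTwisted α m q * sigmaTwisted α n q := by
  simp only [sigmaTwisted_eq_mul_zeta]
  exact ((coprimeCpow_isMultiplicative α q).mul
    ArithmeticFunction.isMultiplicative_zeta.natCast).map_mul_of_coprime h

lemma sigmaTwisted_prime_pow (α : ℂ) (q : ℕ) {p : ℕ} (hp : p.Prime) (k : ℕ) :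
    sigmaTwisted α (p ^ k) q =
      ∑ i ∈ Finset.range (k + 1), (if p ∣ q then 0 else (p : ℂ) ^ α) ^ i := by
  rw [sigmaTwisted, Finset.sum_filter, Nat.sum_divisors_prime_pow hp]
  refine Finset.sum_congr rfl fun i _ => ?_
  rcases Nat.eq_zero_or_pos i with rfl | hi
  · simp
  · have : (p ^ i).gcd q = 1 ↔ ¬ p ∣ q := by
      rw [← Nat.Coprime, Nat.coprime_pow_left_iff hi, hp.coprime_iff_not_dvd]
    simp only [this]
    split_ifs with h
    · simp_all [hi.ne']
    · rw [Nat.cast_pow, ← Complex.natCast_cpow_natCast_mul, Complex.cpow_nat_mul]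

lemma norm_sigmaTwisted_le (α : ℂ) (q : ℕ) {n : ℕ} (hn : n ≠ 0) :
    ‖sigmaTwisted α n q‖ ≤ n.divisors.card * (n : ℝ) ^ max 0 α.re := by
  have hb : ∀ d ∈ n.divisors.filter (fun d => Nat.gcd d q = 1),
      ‖(d : ℂ) ^ α‖ ≤ (n : ℝ) ^ max 0 α.re := by
    intro d hd
    have hd' := (Finset.mem_filter.mp hd).1
    have hpos := Nat.pos_of_mem_divisors hd'
    rw [Complex.norm_natCast_cpow_of_pos hpos]
    calc (d : ℝ) ^ α.re ≤ (d : ℝ) ^ max 0 α.re :=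
          Real.rpow_le_rpow_of_exponent_le (mod_cast hpos) (le_max_right _ _)
      _ ≤ _ := Real.rpow_le_rpow (by positivity) (mod_cast Nat.divisor_le hd') (le_max_left _ _)
  refine (norm_sum_le_of_le _ hb).trans ?_
  rw [Finset.sum_const, nsmul_eq_mul]
  gcongr
  exact Finset.filter_subset _ _

lemma card_divisors_mul_le (m n : ℕ) :
    (m * n).divisors.card ≤ m.divisors.card * n.divisors.card := by
  open scoped Pointwise in
  rw [Nat.divisors_mul]
  exact Finset.card_mul_le

lemma card_divisors_sq_le (n : ℕ) :
    n.divisors.card ^ 2 ≤ ((ζ * ζ) * (ζ * ζ) : ArithmeticFunction ℕ) n := by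
  have hz : ∀ m, (ζ * ζ : ArithmeticFunction ℕ) m = m.divisors.card := fun m => by
    rw [ArithmeticFunction.zeta_mul_apply, Finset.card_eq_sum_ones]
    exact Finset.sum_congr rfl fun d hd => by simp [(Nat.pos_of_mem_divisors hd).ne']
  rw [ArithmeticFunction.mul_apply]
  simp only [hz]
  calc n.divisors.card ^ 2 = ∑ _x ∈ n.divisorsAntidiagonal, n.divisors.card := by
        rw [Finset.sum_const, sq, smul_eq_mul, ← Nat.map_div_right_divisors, Finset.card_map]
    _ ≤ _ := Finset.sum_le_sum fun x hx => by
        rw [← (Nat.mem_divisorsAntidiagonal.mp hx).1]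
        exact card_divisors_mul_le _ _

lemma summable_card_divisors_sq {t : ℝ} (ht : 1 < t) :
    Summable fun n : ℕ => (n.divisors.card : ℝ) ^ 2 * (n : ℝ) ^ (-t) := by
  have hz : LSeriesSummable (fun n => ((ζ : ArithmeticFunction ℂ) n)) (t : ℂ) := by
    have ht' : 1 < (t : ℂ).re := by simpa using ht
    simpa using ArithmeticFunction.LSeriesSummable_zeta_iff.mpr ht'
  have h2 := ArithmeticFunction.LSeriesSummable_mul hz hz
  have h4 := (ArithmeticFunction.LSeriesSummable_mul h2 h2).norm
  refine Summable.of_nonneg_of_le (fun n => by positivity) (fun n => ?_) h4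
  rcases Nat.eq_zero_or_pos n with rfl | hn
  · simp
  · rw [LSeries.norm_term_eq, if_neg hn.ne', Complex.ofReal_re, Real.rpow_neg (by positivity),
      div_eq_mul_inv]
    gcongr
    rw [← ArithmeticFunction.natCoe_mul, ← ArithmeticFunction.natCoe_mul,
      ArithmeticFunction.natCoe_apply, Complex.norm_natCast]
    exact_mod_cast card_divisors_sq_le n

lemma hasSum_geom_sum_mul_pow {a x : ℂ} (hx : ‖x‖ < 1) (hax : ‖a * x‖ < 1) :
    HasSum (fun k => (∑ i ∈ Finset.range (k + 1), a ^ i) * x ^ k)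
      ((1 - x)⁻¹ * (1 - a * x)⁻¹) := by
  have h := hasSum_sum_range_mul_of_summable_norm (f := fun i => (a * x) ^ i)
    (g := fun i => x ^ i)
    (summable_norm_geometric_of_norm_lt_one hax) (summable_norm_geometric_of_norm_lt_one hx)
  rw [tsum_geometric_of_norm_lt_one hax, tsum_geometric_of_norm_lt_one hx, mul_comm (1 - a * x)⁻¹] at h
  refine h.congr_fun fun k => ?_
  rw [Finset.sum_mul]
  refine Finset.sum_congr rfl fun i hi => ?_
  rw [mul_pow, mul_assoc, ← pow_add, Nat.add_sub_cancel' (Finset.mem_range_succ_iff.mp hi)]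

lemma one_sub_ne_zero_of_norm_lt_one {z : ℂ} (hz : ‖z‖ < 1) : 1 - z ≠ 0 := by
  rintro h
  rw [← sub_eq_zero.mp h] at hz
  simp at hz

/-- The local factor in Ramanujan's formula for `∑ σ_α(n) σ_β(n) n^{-s}`. -/
lemma tsum_geom_sum_mul_geom_sum_mul_pow {a b x : ℂ} (hx : ‖x‖ < 1) (hax : ‖a * x‖ < 1)
    (hbx : ‖b * x‖ < 1) (habx : ‖a * b * x‖ < 1)
    (hS : Summable fun k => (∑ i ∈ Finset.range (k + 1), b ^ i) *
      (∑ i ∈ Finset.range (k + 1), a ^ i) * x ^ k) :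
    ∑' k, (∑ i ∈ Finset.range (k + 1), b ^ i) * (∑ i ∈ Finset.range (k + 1), a ^ i) * x ^ k =
      (1 - a * b * x ^ 2) * ((1 - x)⁻¹ * (1 - a * x)⁻¹ * (1 - b * x)⁻¹ * (1 - a * b * x)⁻¹) := by
  have key : ∀ k, (∑ i ∈ Finset.range (k + 1 + 1), b ^ i) *
      (∑ i ∈ Finset.range (k + 1 + 1), a ^ i) * x ^ (k + 1) =
      x * x ^ k + x * a * ((∑ i ∈ Finset.range (k + 1), a ^ i) * x ^ k) +
      x * b * ((∑ i ∈ Finset.range (k + 1), b ^ i) * x ^ k) +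
      x * (a * b) * ((∑ i ∈ Finset.range (k + 1), b ^ i) *
        (∑ i ∈ Finset.range (k + 1), a ^ i) * x ^ k) := fun k => by
    rw [geom_sum_succ (n := k + 1), geom_sum_succ (n := k + 1)]
    ring
  have hrec := (((hasSum_geometric_of_norm_lt_one hx).mul_left x).add
    ((hasSum_geom_sum_mul_pow hx hax).mul_left (x * a))).add
    ((hasSum_geom_sum_mul_pow hx hbx).mul_left (x * b)) |>.add (hS.hasSum.mul_left (x * (a * b)))
  have h0 := hS.tsum_eq_zero_add
  simp only [key] at h0
  rw [hrec.tsum_eq] at h0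
  set S := ∑' k, (∑ i ∈ Finset.range (k + 1), b ^ i) *
    (∑ i ∈ Finset.range (k + 1), a ^ i) * x ^ k
  have n1 := one_sub_ne_zero_of_norm_lt_one hx
  have n2 := one_sub_ne_zero_of_norm_lt_one hax
  have n3 := one_sub_ne_zero_of_norm_lt_one hbx
  have n4 := one_sub_ne_zero_of_norm_lt_one habx
  simp only [zero_add, Finset.range_one, Finset.sum_singleton, pow_zero, mul_one] at h0
  rw [mul_comm a x] at n2
  rw [mul_comm b x] at n3
  rw [mul_comm (a * b) x, ← mul_assoc] at n4
  field_simp at h0 ⊢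
  linear_combination h0

lemma hasProd_primeFactors {n : ℕ} (hn : n ≠ 0) (g : ℕ → ℂ) :
    HasProd (fun p : Nat.Primes => if (p : ℕ) ∣ n then g p else 1)
      (∏ p ∈ n.primeFactors, g p) := by
  have h : HasProd (({p : ℕ | p.Prime}).mulIndicator fun p => if p ∣ n then g p else 1)
      (∏ p ∈ n.primeFactors, g p) := by
    rw [Finset.prod_congr rfl (g := ({p : ℕ | p.Prime}).mulIndicator
      fun p => if p ∣ n then g p else 1) fun p hp => ?_]
    · refine hasProd_prod_of_ne_finset_one fun p hp => ?_
      rw [Set.mulIndicator_apply]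
      split_ifs with h1 h2
      · exact absurd (Nat.mem_primeFactors.mpr ⟨h1, h2, hn⟩) hp
      all_goals rfl
    · have := Nat.mem_primeFactors.mp hp
      simp [this.1, this.2.1]
  exact hasProd_subtype_iff_mulIndicator.mpr h

lemma norm_prime_cpow_neg_lt_one (p : Nat.Primes) {s : ℂ} (hs : 0 < s.re) :
    ‖(p : ℂ) ^ (-s)‖ < 1 := by
  rw [Complex.norm_natCast_cpow_of_pos p.2.pos]
  exact Real.rpow_lt_one_of_one_lt_of_neg (mod_cast p.2.one_lt) (by simpa using hs)

lemma LPrincipal_hasProd {q : ℕ} (hq : q ≠ 0) {s : ℂ} (hs : 1 < s.re) :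
    HasProd (fun p : Nat.Primes => if (p : ℕ) ∣ q then 1 else (1 - (p : ℂ) ^ (-s))⁻¹)
      (LPrincipal q s) := by
  refine ((riemannZeta_eulerProduct_hasProd hs).mul
    (hasProd_primeFactors hq fun p => 1 - (p : ℂ) ^ (-s))).congr_fun fun p => ?_
  have := one_sub_ne_zero_of_norm_lt_one (norm_prime_cpow_neg_lt_one p (zero_lt_one.trans hs))
  split_ifs <;> simp [this]

lemma LPrincipal_ne_zero (q : ℕ) {s : ℂ} (hs : 1 < s.re) : LPrincipal q s ≠ 0 :=
  mul_ne_zero (riemannZeta_ne_zero_of_one_lt_re hs) <| Finset.prod_ne_zero_iff.mpr fun p hp =>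
    one_sub_ne_zero_of_norm_lt_one
      (norm_prime_cpow_neg_lt_one ⟨p, Nat.prime_of_mem_primeFactors hp⟩ (zero_lt_one.trans hs))

/-- The summand of the coprime twisted divisor series, as a function on `ℕ`. -/
noncomputable def coprimeSigmaTerm (q l : ℕ) (α β s : ℂ) (n : ℕ) : ℂ :=
  if Nat.gcd n l = 1 then sigmaTwisted β n q * sigmaC α n * (n : ℂ) ^ (-s) else 0

lemma coprimeSigmaTerm_one (q l : ℕ) (α β s : ℂ) : coprimeSigmaTerm q l α β s 1 = 1 := by
  simp [coprimeSigmaTerm, sigmaTwisted, sigmaC, Finset.filter_singleton]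

lemma coprimeSigmaTerm_zero (q l : ℕ) (α β s : ℂ) : coprimeSigmaTerm q l α β s 0 = 0 := by
  simp [coprimeSigmaTerm, sigmaTwisted]

lemma coprimeSigmaTerm_mul (q l : ℕ) (α β s : ℂ) {m n : ℕ} (h : m.Coprime n) :
    coprimeSigmaTerm q l α β s (m * n) =
      coprimeSigmaTerm q l α β s m * coprimeSigmaTerm q l α β s n := by
  have hg : (m * n).gcd l = 1 ↔ m.gcd l = 1 ∧ n.gcd l = 1 := Nat.coprime_mul_iff_left
  simp only [coprimeSigmaTerm, ← sigmaTwisted_one, hg, sigmaTwisted_mul _ _ h, Nat.cast_mul,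
    Complex.natCast_mul_natCast_cpow]
  by_cases h1 : m.gcd l = 1 <;> by_cases h2 : n.gcd l = 1 <;> simp only [h1, h2, and_self,
    and_true, and_false, if_true, if_false, mul_zero, zero_mul]
  ring

lemma summable_norm_coprimeSigmaTerm (q l : ℕ) {α β s : ℂ}
    (hs : 1 + max 0 α.re + max 0 β.re < s.re) :
    Summable fun n => ‖coprimeSigmaTerm q l α β s n‖ := by
  refine Summable.of_nonneg_of_le (fun n => norm_nonneg _) (fun n => ?_)
    (summable_card_divisors_sq (t := s.re - max 0 α.re - max 0 β.re) (by linarith))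
  rcases Nat.eq_zero_or_pos n with rfl | hn
  · simp [coprimeSigmaTerm_zero]
  have hn' : (0 : ℝ) < n := mod_cast hn
  rw [coprimeSigmaTerm]
  split_ifs
  · rw [norm_mul, norm_mul, Complex.norm_natCast_cpow_of_pos hn, ← sigmaTwisted_one]
    calc _ ≤ (n.divisors.card * (n : ℝ) ^ max 0 β.re) * (n.divisors.card * (n : ℝ) ^ max 0 α.re) *
          (n : ℝ) ^ (-s).re := by
          gcongr <;> exact norm_sigmaTwisted_le _ _ hn.ne'
      _ = n.divisors.card ^ 2 *
          ((n : ℝ) ^ max 0 β.re * (n : ℝ) ^ max 0 α.re * (n : ℝ) ^ (-s).re) := by ring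
      _ = _ := by
          rw [← Real.rpow_add hn', ← Real.rpow_add hn', Complex.neg_re]
          congr 2
          ring
  · rw [norm_zero]
    positivity

lemma coprimeSigmaTerm_prime_pow_of_dvd (q : ℕ) {l : ℕ} (α β s : ℂ) {p : ℕ} (hp : p.Prime)
    (hpl : p ∣ l) {k : ℕ} (hk : k ≠ 0) : coprimeSigmaTerm q l α β s (p ^ k) = 0 := by
  rw [coprimeSigmaTerm, if_neg]
  rw [← Nat.Coprime, Nat.coprime_pow_left_iff (Nat.pos_of_ne_zero hk), hp.coprime_iff_not_dvd]
  simpa using hpl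

lemma coprimeSigmaTerm_prime_pow_of_not_dvd (q : ℕ) {l : ℕ} (α β s : ℂ) {p : ℕ} (hp : p.Prime)
    (hpl : ¬ p ∣ l) (k : ℕ) : coprimeSigmaTerm q l α β s (p ^ k) =
      (∑ i ∈ Finset.range (k + 1), (if p ∣ q then 0 else (p : ℂ) ^ β) ^ i) *
        (∑ i ∈ Finset.range (k + 1), ((p : ℂ) ^ α) ^ i) * ((p : ℂ) ^ (-s)) ^ k := by
  have hg : (p ^ k).gcd l = 1 := Nat.Coprime.pow_left k ((hp.coprime_iff_not_dvd).mpr hpl)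
  rw [coprimeSigmaTerm, if_pos hg, ← sigmaTwisted_one, sigmaTwisted_prime_pow _ _ hp,
    sigmaTwisted_prime_pow _ _ hp, if_neg (mt Nat.dvd_one.mp hp.ne_one), Nat.cast_pow,
    ← Complex.natCast_cpow_natCast_mul, Complex.cpow_nat_mul]

/-- Ramanujan-type evaluation of `∑_{(n,l)=1} σ_β(n;χ_q) σ_α(n) n^{-s}` for squarefree `q`
and `l ∣ q`. -/
theorem coprime_twisted_sigma_series_eval (q l : ℕ) (hq : Squarefree q)
    (hl : 0 < l) (hlq : l ∣ q) (α β s : ℂ)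
    (hs : 1 + max 0 (max α.re (max β.re (α + β).re)) < s.re) :
    (∑' n : ℕ+,
      if Nat.gcd n l = 1 then sigmaTwisted β n q * sigmaC α n * (n : ℂ) ^ (-s) else 0)
    = LPrincipal q s * LPrincipal q (s - β) * LPrincipal q (s - α) *
        LPrincipal q (s - β - α) / LPrincipal q (2 * s - β - α) *
        ∏ p ∈ (q / l).primeFactors,
          (1 - (p : ℂ) ^ (-s))⁻¹ * (1 - (p : ℂ) ^ (-(s - α)))⁻¹ := by
  have hm0 : 0 ≤ max 0 (max α.re (max β.re (α + β).re)) := le_max_left _ _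
  have hmα : α.re ≤ max 0 (max α.re (max β.re (α + β).re)) := by simp
  have hmβ : β.re ≤ max 0 (max α.re (max β.re (α + β).re)) := by simp
  have hmαβ : α.re + β.re ≤ max 0 (max α.re (max β.re (α + β).re)) := by simp
  have hs0 : 1 < s.re := by linarith
  have hsα : 1 < (s - α).re := by rw [Complex.sub_re]; linarith
  have hsβ : 1 < (s - β).re := by rw [Complex.sub_re]; linarith
  have hsαβ : 1 < (s - β - α).re := by rw [Complex.sub_re, Complex.sub_re]; linarith
  have hs2 : 1 < (2 * s - β - α).re := by
    have : (2 * s - β - α).re = 2 * s.re - β.re - α.re := by simp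
    linarith
  have hq0 : q ≠ 0 := hq.ne_zero
  have hql0 : q / l ≠ 0 := (Nat.div_pos (Nat.le_of_dvd (Nat.pos_of_ne_zero hq0) hlq) hl).ne'
  have hsum := summable_norm_coprimeSigmaTerm q l (α := α) (β := β) (s := s) (by
    rcases max_cases 0 α.re with h | h <;> rcases max_cases 0 β.re with h' | h' <;> linarith)
  have hE := EulerProduct.eulerProduct_hasProd (coprimeSigmaTerm_one q l α β s)
    (coprimeSigmaTerm_mul q l α β s) hsum (coprimeSigmaTerm_zero q l α β s)
  have hL := (hE.mul (LPrincipal_hasProd hq0 hs2))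
  have hR := ((((LPrincipal_hasProd hq0 hs0).mul (LPrincipal_hasProd hq0 hsβ)).mul
    (LPrincipal_hasProd hq0 hsα)).mul (LPrincipal_hasProd hq0 hsαβ)).mul
    (hasProd_primeFactors hql0 fun p => (1 - (p : ℂ) ^ (-s))⁻¹ * (1 - (p : ℂ) ^ (-(s - α)))⁻¹)
  have hS : (∑' n : ℕ+, if Nat.gcd n l = 1 then
      sigmaTwisted β n q * sigmaC α n * (n : ℂ) ^ (-s) else 0) =
      ∑' n, coprimeSigmaTerm q l α β s n := by
    rw [hsum.of_norm.tsum_eq_zero_add, coprimeSigmaTerm_zero, zero_add]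
    exact tsum_pnat_eq_tsum_succ (f := coprimeSigmaTerm q l α β s)
  rw [hS, div_mul_eq_mul_div, eq_div_iff (LPrincipal_ne_zero q hs2)]
  refine hL.unique (hR.congr_fun fun p => ?_)
  have hp := p.2
  have hpC : (p : ℂ) ≠ 0 := mod_cast hp.ne_zero
  have eα : (p : ℂ) ^ (-(s - α)) = (p : ℂ) ^ α * (p : ℂ) ^ (-s) := by
    rw [← Complex.cpow_add _ _ hpC]; congr 1; ring
  have eβ : (p : ℂ) ^ (-(s - β)) = (p : ℂ) ^ β * (p : ℂ) ^ (-s) := by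
    rw [← Complex.cpow_add _ _ hpC]; congr 1; ring
  have eαβ : (p : ℂ) ^ (-(s - β - α)) = (p : ℂ) ^ α * (p : ℂ) ^ β * (p : ℂ) ^ (-s) := by
    rw [← Complex.cpow_add _ _ hpC, ← Complex.cpow_add _ _ hpC]; congr 1; ring
  have e2 : (p : ℂ) ^ (-(2 * s - β - α)) =
      (p : ℂ) ^ α * (p : ℂ) ^ β * ((p : ℂ) ^ (-s)) ^ 2 := by
    rw [sq, ← Complex.cpow_add _ _ hpC, ← Complex.cpow_add _ _ hpC, ← Complex.cpow_add _ _ hpC]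
    congr 1; ring
  have b0 := norm_prime_cpow_neg_lt_one p (zero_lt_one.trans hs0)
  have bα := norm_prime_cpow_neg_lt_one p (zero_lt_one.trans hsα)
  have bβ := norm_prime_cpow_neg_lt_one p (zero_lt_one.trans hsβ)
  have bαβ := norm_prime_cpow_neg_lt_one p (zero_lt_one.trans hsαβ)
  have n2 := one_sub_ne_zero_of_norm_lt_one
    (norm_prime_cpow_neg_lt_one p (zero_lt_one.trans hs2))
  have hsp := hsum.of_norm.comp_injective (Nat.pow_right_injective hp.two_le)
  rw [eα] at bα ⊢
  rw [eβ] at bβ ⊢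
  rw [eαβ] at bαβ ⊢
  rw [e2] at n2 ⊢
  have hdiv : ((p : ℕ) ∣ q / l) ↔ ((p : ℕ) ∣ q ∧ ¬ (p : ℕ) ∣ l) := by
    obtain ⟨m, rfl⟩ := hlq
    have hc := Nat.coprime_of_squarefree_mul hq
    rw [Nat.mul_div_cancel_left _ hl, hp.dvd_mul]
    have : (p : ℕ) ∣ m → ¬ (p : ℕ) ∣ l := fun h1 h2 =>
      hp.ne_one (Nat.eq_one_of_dvd_coprimes hc h2 h1)
    tauto
  by_cases hpl : (p : ℕ) ∣ l
  · have hpq := hpl.trans hlq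
    rw [tsum_eq_single 0 fun k hk => coprimeSigmaTerm_prime_pow_of_dvd q α β s hp hpl hk]
    simp [coprimeSigmaTerm_one, hpq, hdiv, hpl]
  · simp only [Function.comp_def, coprimeSigmaTerm_prime_pow_of_not_dvd q α β s hp hpl] at hsp ⊢
    by_cases hpq : (p : ℕ) ∣ q
    · simp only [hpq, hdiv, hpl, if_true, not_false_eq_true, and_self] at hsp ⊢
      rw [tsum_geom_sum_mul_geom_sum_mul_pow b0 bα (by simp) (by simp) hsp]
      simp
    · simp only [hpq, hdiv, if_false, false_and] at hsp ⊢
      rw [tsum_geom_sum_mul_geom_sum_mul_pow b0 bα bβ bαβ hsp]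
      field_simp
end
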